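/- arXiv:1302.3150 — 2 statements merged into one kernel-verified Lean document; each statement's English description precedes it below -/
import Mathlib

section
/- Let F = αφ(β/α) be a regular Douglas (α,β)-metric on an open subset U ⊆ ℝ² with β nowhere zero, where φ(0) = 1 and φ satisfies (1+(k₁+k₃)s²+k₂s⁴)φ''(s) = (k₁+k₂s²)(φ(s)−sφ'(s)) for constants k₁,k₂,k₃ with k₂ ≠ (2k₁+3k₃)(3k₁+2k₃)/25 and k₂ ≠ k₁k₃. Then around each point there exist local coordinates (x¹,x²) and smooth scalar functions B(x) > 0, u(x), v(x) such that α = (√B/c)·√([(y¹)²+(y²)²]/(u²+v²)) and β = B(uy¹+vy²)/(c(u²+v²)), where c := exp(∫₀^B ½(k₃+k₂t)/(1+(k₁+k₃)t+k₂t²) dt), and B, u, v satisfy the PDEs u_{x¹} = v_{x²}, u_{x²} = −v_{x¹}, v_{x¹} + σ_{x¹}v = u·σ_{x²}, where σ is defined by e^{2σ} = B/(c²(u²+v²)). -/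
open scoped BigOperators
open Real

noncomputable section

/-- Points (and vectors) of the plane. -/
abbrev Pt : Type := Fin 2 → ℝ

/-- Partial derivative of a scalar function on `ℝ²` in the `j`-th coordinate direction. -/
def pd (f : Pt → ℝ) (j : Fin 2) (x : Pt) : ℝ := fderiv ℝ f x (Pi.single j 1)

/-- Christoffel symbols `γ^k_{ij}` of a Riemannian metric `a`. -/
def christoffel (a : Pt → Matrix (Fin 2) (Fin 2) ℝ) (k i j : Fin 2) (x : Pt) : ℝ :=
  (1/2) * ∑ l, (a x)⁻¹ k l *
    (pd (fun z => a z l j) i x + pd (fun z => a z l i) j x - pd (fun z => a z i j) l x)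

/-- Covariant derivative `c_{i|j}` of a 1-form `c` with respect to the metric `a`. -/
def covD (a : Pt → Matrix (Fin 2) (Fin 2) ℝ) (c : Pt → Fin 2 → ℝ) (i j : Fin 2) (x : Pt) : ℝ :=
  pd (fun z => c z i) j x - ∑ k, c x k * christoffel a k i j x

/-- `r_{ij}`, the symmetrized covariant derivative of the 1-form `b`. -/
def rr (a : Pt → Matrix (Fin 2) (Fin 2) ℝ) (b : Pt → Fin 2 → ℝ) (i j : Fin 2) (x : Pt) : ℝ :=
  (covD a b i j x + covD a b j i x) / 2

/-- `s_{ij}`, the antisymmetrized covariant derivative of the 1-form `b`. -/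
def so (a : Pt → Matrix (Fin 2) (Fin 2) ℝ) (b : Pt → Fin 2 → ℝ) (i j : Fin 2) (x : Pt) : ℝ :=
  (covD a b i j x - covD a b j i x) / 2

/-- `bⁱ := a^{ik} b_k`. -/
def bUp (a : Pt → Matrix (Fin 2) (Fin 2) ℝ) (b : Pt → Fin 2 → ℝ) (i : Fin 2) (x : Pt) : ℝ :=
  ∑ k, (a x)⁻¹ i k * b x k

/-- `b² := a^{ij} b_i b_j`, the squared norm of `β` with respect to `α`. -/
def bsq (a : Pt → Matrix (Fin 2) (Fin 2) ℝ) (b : Pt → Fin 2 → ℝ) (x : Pt) : ℝ :=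
  ∑ i, bUp a b i x * b x i

/-- `s_j := bⁱ s_{ij}`. -/
def sLow (a : Pt → Matrix (Fin 2) (Fin 2) ℝ) (b : Pt → Fin 2 → ℝ) (j : Fin 2) (x : Pt) : ℝ :=
  ∑ i, bUp a b i x * so a b i j x

/-- `sⁱ := a^{ik} s_k`. -/
def sUp (a : Pt → Matrix (Fin 2) (Fin 2) ℝ) (b : Pt → Fin 2 → ℝ) (i : Fin 2) (x : Pt) : ℝ :=
  ∑ k, (a x)⁻¹ i k * sLow a b k x

/-- `s₀ := s_j y^j`. -/
def sZero (a : Pt → Matrix (Fin 2) (Fin 2) ℝ) (b : Pt → Fin 2 → ℝ) (x : Pt) (y : Fin 2 → ℝ) : ℝ :=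
  ∑ j, sLow a b j x * y j

/-- The Riemannian norm `α(x,y) = √(a_{ij} yⁱ yʲ)`. -/
def alphaF (a : Pt → Matrix (Fin 2) (Fin 2) ℝ) (x : Pt) (y : Fin 2 → ℝ) : ℝ :=
  Real.sqrt (∑ i, ∑ j, a x i j * y i * y j)

/-- The 1-form `β(x,y) = b_i(x) yⁱ`. -/
def betaF (b : Pt → Fin 2 → ℝ) (x : Pt) (y : Fin 2 → ℝ) : ℝ := ∑ i, b x i * y i

/-- Fundamental tensor `g_{ij} := ½ [F²]_{yⁱyʲ}` of a Finsler metric `F`. -/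
def gMat (F : Pt → (Fin 2 → ℝ) → ℝ) (x : Pt) (y : Fin 2 → ℝ) : Matrix (Fin 2) (Fin 2) ℝ :=
  Matrix.of fun i j =>
    (1/2) * fderiv ℝ (fun y1 => fderiv ℝ (fun y2 => (F x y2)^2) y1 (Pi.single j 1)) y
      (Pi.single i 1)

/-- Spray coefficients `Gⁱ := ¼ g^{il} ([F²]_{x^k y^l} y^k − [F²]_{x^l})` of a Finsler metric. -/
def spray (F : Pt → (Fin 2 → ℝ) → ℝ) (i : Fin 2) (x : Pt) (y : Fin 2 → ℝ) : ℝ :=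
  (1/4) * ∑ l, (gMat F x y)⁻¹ i l *
    ((∑ k, (fderiv ℝ (fun x' => fderiv ℝ (fun y' => (F x' y')^2) y (Pi.single l 1)) x
        (Pi.single k 1)) * y k)
      - fderiv ℝ (fun x' => (F x' y)^2) x (Pi.single l 1))

/-- `F` is a Douglas metric on `U`: for each `x ∈ U`, `G¹y² − G²y¹` is a homogeneous
polynomial of degree 3 in `(y¹, y²)`. -/
def IsDouglasOn (F : Pt → (Fin 2 → ℝ) → ℝ) (U : Set Pt) : Prop :=
  ∀ x ∈ U, ∃ c0 c1 c2 c3 : ℝ, ∀ y : Fin 2 → ℝ, y ≠ 0 →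
    spray F 0 x y * y 1 - spray F 1 x y * y 0 =
      c0 * (y 0)^3 + c1 * (y 0)^2 * y 1 + c2 * (y 0) * (y 1)^2 + c3 * (y 1)^3

/-- The Hamel operator `F_{x^m y^l} y^m − F_{x^l}`. -/
def Hamel (F : Pt → (Fin 2 → ℝ) → ℝ) (x : Pt) (y : Fin 2 → ℝ) (l : Fin 2) : ℝ :=
  (∑ m, fderiv ℝ (fun x' => fderiv ℝ (fun y' => F x' y') y (Pi.single l 1)) x
      (Pi.single m 1) * y m)
    - fderiv ℝ (fun x' => F x' y) x (Pi.single l 1)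

/-- `F` is projectively flat on `U` (Hamel equations). -/
def ProjFlatOn (F : Pt → (Fin 2 → ℝ) → ℝ) (U : Set Pt) : Prop :=
  ∀ x ∈ U, ∀ y : Fin 2 → ℝ, y ≠ 0 → ∀ l, Hamel F x y l = 0

/-- Spray coefficients `G^i_α := ½ γ^i_{jk} y^j y^k` of the Riemannian metric `α`. -/
def sprayA (a : Pt → Matrix (Fin 2) (Fin 2) ℝ) (i : Fin 2) (x : Pt) (y : Fin 2 → ℝ) : ℝ :=
  (1/2) * ∑ j, ∑ k, christoffel a i j k x * y j * y k

/-- The projective factor `P = F_{x^m} y^m / (2F)`. -/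
def projFac (F : Pt → (Fin 2 → ℝ) → ℝ) (x : Pt) (y : Fin 2 → ℝ) : ℝ :=
  (∑ m, fderiv ℝ (fun x' => F x' y) x (Pi.single m 1) * y m) / (2 * F x y)

/-- Pullback of a Finsler metric under a coordinate map `ψ`. -/
def pullF (F : Pt → (Fin 2 → ℝ) → ℝ) (ψ : Pt → Pt) : Pt → (Fin 2 → ℝ) → ℝ :=
  fun z y => F (ψ z) (fderiv ℝ ψ z y)

/-- `ψ` is a (curvilinear) coordinate chart: a smooth injective map from the open set `V`
into `U` with everywhere invertible differential. -/
def IsCoordChart (ψ : Pt → Pt) (V U : Set Pt) : Prop :=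
  IsOpen V ∧ ContDiffOn ℝ (⊤ : ℕ∞) ψ V ∧ Set.InjOn ψ V ∧ ψ '' V ⊆ U ∧
    ∀ z ∈ V, LinearMap.det ((fderiv ℝ ψ z) : Pt →ₗ[ℝ] Pt) ≠ 0

/-- `F` is locally projectively flat on `U`: around every point there are local coordinates
in which `F` satisfies the Hamel equations. -/
def IsLocProjFlatOn (F : Pt → (Fin 2 → ℝ) → ℝ) (U : Set Pt) : Prop :=
  ∀ x ∈ U, ∃ (V : Set Pt) (ψ : Pt → Pt), IsCoordChart ψ V U ∧ x ∈ ψ '' V ∧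
    ProjFlatOn (pullF F ψ) V

/-- A quartic polynomial vanishing on an interval `(0, ε)` has zero coefficients. -/
lemma quartic_coeffs_eq_zero {c₀ c₁ c₂ c₃ c₄ ε : ℝ} (hε : 0 < ε)
    (h : ∀ t ∈ Set.Ioo 0 ε, c₀ + c₁ * t + c₂ * t ^ 2 + c₃ * t ^ 3 + c₄ * t ^ 4 = 0) :
    c₀ = 0 ∧ c₁ = 0 ∧ c₂ = 0 ∧ c₃ = 0 ∧ c₄ = 0 := by
  open Polynomial in
  set P : ℝ[X] := C c₀ + C c₁ * X + C c₂ * X ^ 2 + C c₃ * X ^ 3 + C c₄ * X ^ 4 with hP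
  have hP0 : P = 0 := by
    refine Polynomial.eq_zero_of_infinite_isRoot P ((Set.Ioo_infinite hε).mono fun t ht => ?_)
    simpa [hP, Polynomial.IsRoot] using h t ht
  have hc : ∀ n, P.coeff n = 0 := fun n => by rw [hP0, Polynomial.coeff_zero]
  have h0 := hc 0
  have h1 := hc 1
  have h2 := hc 2
  have h3 := hc 3
  have h4 := hc 4
  simp [hP, Polynomial.coeff_X, Polynomial.coeff_X_pow, Polynomial.coeff_C] at h0 h1 h2 h3 h4
  exact ⟨h0, h1, h2, h3, h4⟩

/-- If a solution `Q` of `Q' = (k₁ + k₂ s²)(1 + s Q) / D`, `D = 1 + (k₁ + k₃) s² + k₂ s⁴`, becomes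
an odd quintic after multiplication by `D`, then the constants are exceptional. -/
lemma exceptional_of_mul_eq_quintic {k₁ k₂ k₃ r q₀ q₁ q₂ : ℝ} (hr : 0 < r) {Q : ℝ → ℝ}
    (hD : ∀ s ∈ Set.Ioo 0 r, 1 + (k₁ + k₃) * s ^ 2 + k₂ * s ^ 4 ≠ 0)
    (hQ : ∀ s ∈ Set.Ioo 0 r, HasDerivAt Q
      ((k₁ + k₂ * s ^ 2) / (1 + (k₁ + k₃) * s ^ 2 + k₂ * s ^ 4) * (1 + s * Q s)) s)
    (hP : ∀ s ∈ Set.Ioo 0 r, Q s * (1 + (k₁ + k₃) * s ^ 2 + k₂ * s ^ 4)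
      = q₀ * s + q₁ * s ^ 3 + q₂ * s ^ 5) :
    (k₂ - k₁ * k₃) * (25 * k₂ - (2 * k₁ + 3 * k₃) * (3 * k₁ + 2 * k₃)) = 0 := by
  have key : ∀ s ∈ Set.Ioo 0 r,
      (q₀ + 3 * q₁ * s ^ 2 + 5 * q₂ * s ^ 4) * (1 + (k₁ + k₃) * s ^ 2 + k₂ * s ^ 4)
        - (q₀ * s + q₁ * s ^ 3 + q₂ * s ^ 5) * (2 * (k₁ + k₃) * s + 4 * k₂ * s ^ 3)
      = (k₁ + k₂ * s ^ 2) * ((1 + (k₁ + k₃) * s ^ 2 + k₂ * s ^ 4)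
        + s * (q₀ * s + q₁ * s ^ 3 + q₂ * s ^ 5)) := by
    intro s hs
    have hDd : HasDerivAt (fun s : ℝ => 1 + (k₁ + k₃) * s ^ 2 + k₂ * s ^ 4)
        ((k₁ + k₃) * (2 * s) + k₂ * (4 * s ^ 3)) s := by
      have h := (((hasDerivAt_pow 2 s).const_mul (k₁ + k₃)).const_add 1).fun_add
        ((hasDerivAt_pow 4 s).const_mul k₂)
      simpa using h
    have hPd : HasDerivAt (fun s : ℝ => q₀ * s + q₁ * s ^ 3 + q₂ * s ^ 5)
        (q₀ + q₁ * (3 * s ^ 2) + q₂ * (5 * s ^ 4)) s := by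
      have h := (((hasDerivAt_id s).const_mul q₀).fun_add ((hasDerivAt_pow 3 s).const_mul q₁)).fun_add
        ((hasDerivAt_pow 5 s).const_mul q₂)
      simpa using h
    have h1 := (hQ s hs).mul hDd
    have h2 : HasDerivAt (fun s : ℝ => q₀ * s + q₁ * s ^ 3 + q₂ * s ^ 5) _ s :=
      h1.congr_of_eventuallyEq
        (Filter.eventually_of_mem (isOpen_Ioo.mem_nhds hs) fun t ht => (hP t ht).symm)
    have h3 := hPd.unique h2
    have hDs := hD s hs
    have hPs := hP s hs
    rw [mul_right_comm, div_mul_cancel₀ _ hDs] at h3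
    linear_combination (1 + (k₁ + k₃) * s ^ 2 + k₂ * s ^ 4) * h3
      + ((k₁ + k₂ * s ^ 2) * s + ((k₁ + k₃) * (2 * s) + k₂ * (4 * s ^ 3))) * hPs
  have hc := quartic_coeffs_eq_zero (c₀ := q₀ - k₁)
    (c₁ := 3 * q₁ - (k₁ + k₃) * q₀ - k₁ * (k₁ + k₃) - k₂ - k₁ * q₀)
    (c₂ := 5 * q₂ + (k₁ + k₃) * q₁ - 3 * k₂ * q₀ - k₁ * k₂ - k₂ * (k₁ + k₃) - k₁ * q₁ - k₂ * q₀)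
    (c₃ := 3 * (k₁ + k₃) * q₂ - k₂ * q₁ - k₂ ^ 2 - k₁ * q₂ - k₂ * q₁)
    (c₄ := 0) (ε := r ^ 2) (by positivity) (by
      intro t ht
      have hs : √t ∈ Set.Ioo 0 r :=
        ⟨Real.sqrt_pos.2 ht.1, (Real.sqrt_lt' hr).2 ht.2⟩
      have h := key _ hs
      have e2 : √t ^ 2 = t := Real.sq_sqrt ht.1.le
      have e4 : √t ^ 4 = t ^ 2 := by rw [← e2]; ring_nf; rw [e2]
      generalize √t = s at h e2 e4
      subst e2
      linear_combination h)
  obtain ⟨h0, h1, h2, h3, -⟩ := hc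
  have e0 : q₀ = k₁ := by linarith
  subst e0
  have e1 : q₁ = (3 * q₀ ^ 2 + 2 * q₀ * k₃ + k₂) / 3 := by linarith
  subst e1
  have e2 : q₂ = (18 * q₀ * k₂ + 2 * k₂ * k₃ - 3 * q₀ ^ 2 * k₃ - 2 * q₀ * k₃ ^ 2) / 15 := by
    linarith
  subst e2
  linear_combination (-15) * h3

/-- The Douglas condition at a point, written in an adapted orthogonal frame, forces the
antisymmetric part `S` to vanish and the symmetric part `(R₀, R₁, R₂)` to have the expected shape. -/
lemma frame_conditions {k₁ k₂ k₃ B m₀ m₁ m₂ m₃ l S R₀ R₁ R₂ : ℝ} (hB : 0 < B) (hl : l ≠ 0)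
    (hk : k₂ ≠ (2 * k₁ + 3 * k₃) * (3 * k₁ + 2 * k₃) / 25) (hk' : k₂ ≠ k₁ * k₃)
    (hDB : 1 + (k₁ + k₃) * B + k₂ * B ^ 2 ≠ 0) {Q : ℝ → ℝ}
    (hD : ∀ s ∈ Set.Ioo 0 (√B), 1 + (k₁ + k₃) * s ^ 2 + k₂ * s ^ 4 ≠ 0)
    (hQ : ∀ s ∈ Set.Ioo 0 (√B), HasDerivAt Q
      ((k₁ + k₂ * s ^ 2) / (1 + (k₁ + k₃) * s ^ 2 + k₂ * s ^ 4) * (1 + s * Q s)) s)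
    (h : ∀ p q : ℝ, p ^ 2 + q ^ 2 = 1 →
      -(m₀ * p ^ 3 + m₁ * p ^ 2 * q + m₂ * p * q ^ 2 + m₃ * q ^ 3)
          * ((1 + k₁ * B) * q ^ 2 + (1 + (k₁ + k₃) * B + k₂ * B ^ 2) * p ^ 2)
        + l * q * (k₁ + k₂ * B * p ^ 2) * (R₀ * p ^ 2 + R₁ * p * q + R₂ * q ^ 2)
      = S * Q (√B * p) * (1 + (k₁ + k₃) * (√B * p) ^ 2 + k₂ * (√B * p) ^ 4)) :
    S = 0 ∧ R₁ = 0 ∧ R₀ * (1 + k₁ * B) = R₂ * (1 + (k₁ + k₃) * B + k₂ * B ^ 2) := by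
  set g := 1 + k₁ * B with hgdef
  set D := 1 + (k₁ + k₃) * B + k₂ * B ^ 2 with hDdef
  have hsB : 0 < √B := Real.sqrt_pos.2 hB
  have hsB2 : √B ^ 2 = B := Real.sq_sqrt hB.le
  -- split into the parts even and odd in `q`
  have heven : ∀ p q : ℝ, p ^ 2 + q ^ 2 = 1 →
      p * (-(m₀ * p ^ 2 + m₂ * q ^ 2) * (g * q ^ 2 + D * p ^ 2)
        + l * q ^ 2 * (k₁ + k₂ * B * p ^ 2) * R₁)
      = S * Q (√B * p) * (1 + (k₁ + k₃) * (√B * p) ^ 2 + k₂ * (√B * p) ^ 4) := by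
    intro p q hpq
    have h1 := h p q hpq
    have h2 := h p (-q) (by rw [neg_sq]; exact hpq)
    linear_combination h1 / 2 + h2 / 2
  have hodd : ∀ p q : ℝ, p ^ 2 + q ^ 2 = 1 →
      q * (-(m₁ * p ^ 2 + m₃ * q ^ 2) * (g * q ^ 2 + D * p ^ 2)
        + l * (k₁ + k₂ * B * p ^ 2) * (R₀ * p ^ 2 + R₂ * q ^ 2)) = 0 := by
    intro p q hpq
    have h1 := h p q hpq
    have h2 := h p (-q) (by rw [neg_sq]; exact hpq)
    linear_combination h1 / 2 - h2 / 2
  have hS : S = 0 := by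
    by_contra hS
    have := exceptional_of_mul_eq_quintic (k₁ := k₁) (k₂ := k₂) (k₃ := k₃) (r := √B) (Q := Q)
      (q₀ := (-m₂ * g + l * k₁ * R₁) / (S * √B))
      (q₁ := (-(m₀ - m₂) * g - m₂ * (D - g) + l * R₁ * (k₂ * B - k₁)) / (S * √B ^ 3))
      (q₂ := (-(m₀ - m₂) * (D - g) - l * R₁ * k₂ * B) / (S * √B ^ 5)) hsB hD hQ (by
        intro s hs
        have hp1 : (s / √B) ^ 2 < 1 := by
          rw [div_pow, div_lt_one (by positivity)]
          exact pow_lt_pow_left₀ hs.2 hs.1.le two_ne_zero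
        have hq : √(1 - (s / √B) ^ 2) ^ 2 = 1 - (s / √B) ^ 2 := Real.sq_sqrt (by linarith)
        have h1 := heven (s / √B) (√(1 - (s / √B) ^ 2)) (by rw [hq]; ring)
        rw [hq, mul_div_cancel₀ _ hsB.ne'] at h1
        have h2 : Q s * (1 + (k₁ + k₃) * s ^ 2 + k₂ * s ^ 4) =
          (S * Q s * (1 + (k₁ + k₃) * s ^ 2 + k₂ * s ^ 4)) / S := by field_simp
        rw [h2, ← h1]
        clear_value g D
        field_simp
        ring)
    rcases mul_eq_zero.1 this with h0 | h0
    · exact hk' (by linarith)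
    · exact hk (by linarith)
  have hne : g * (k₁ + k₂ * B) - k₁ * D ≠ 0 := by
    have : g * (k₁ + k₂ * B) - k₁ * D = B * (k₂ - k₁ * k₃) := by rw [hgdef, hDdef]; ring
    rw [this]
    exact mul_ne_zero hB.ne' (sub_ne_zero.2 hk')
  have hpar : ∀ t ∈ Set.Ioo (0 : ℝ) 1, ∃ p q : ℝ, p ≠ 0 ∧ q ≠ 0 ∧ p ^ 2 = t ∧ q ^ 2 = 1 - t :=
    fun t ht => ⟨√t, √(1 - t), (Real.sqrt_pos.2 ht.1).ne', (Real.sqrt_pos.2 (by linarith [ht.2])).ne',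
      Real.sq_sqrt ht.1.le, Real.sq_sqrt (by linarith [ht.2])⟩
  have he := quartic_coeffs_eq_zero (ε := 1) (c₀ := -m₂ * g + l * k₁ * R₁)
    (c₁ := -(m₀ - m₂) * g - m₂ * (D - g) + l * R₁ * (k₂ * B - k₁))
    (c₂ := -(m₀ - m₂) * (D - g) - l * R₁ * k₂ * B) (c₃ := 0) (c₄ := 0) one_pos (by
      intro t ht
      obtain ⟨p, q, hp, hq, hpt, hqt⟩ := hpar t ht
      have h1 := heven p q (by rw [hpt, hqt]; ring)
      rw [hS, zero_mul, zero_mul, mul_eq_zero, or_iff_right hp, hqt, hpt] at h1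
      linear_combination h1)
  have ho := quartic_coeffs_eq_zero (ε := 1) (c₀ := -m₃ * g + l * k₁ * R₂)
    (c₁ := -(m₁ - m₃) * g - m₃ * (D - g) + l * k₁ * (R₀ - R₂) + l * k₂ * B * R₂)
    (c₂ := -(m₁ - m₃) * (D - g) + l * k₂ * B * (R₀ - R₂)) (c₃ := 0) (c₄ := 0) one_pos (by
      intro t ht
      obtain ⟨p, q, hp, hq, hpt, hqt⟩ := hpar t ht
      have h1 := hodd p q (by rw [hpt, hqt]; ring)
      rw [mul_eq_zero, or_iff_right hq, hqt, hpt] at h1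
      linear_combination h1)
  obtain ⟨e0, e1, e2, -, -⟩ := he
  obtain ⟨o0, o1, o2, -, -⟩ := ho
  clear_value g D
  refine ⟨hS, ?_, ?_⟩
  · have hm₀ : m₀ = 0 := by
      have : m₀ * D = 0 := by linear_combination -(e0 + e1 + e2)
      exact (mul_eq_zero.1 this).resolve_right hDB
    subst hm₀
    have : l * (g * (k₁ + k₂ * B) - k₁ * D) * R₁ = 0 := by
      linear_combination (2 * g - D) * e0 + g * e1
    exact (mul_eq_zero.1 this).resolve_left (mul_ne_zero hl hne)
  · have : l * (g * (k₁ + k₂ * B) - k₁ * D) * (R₀ * g - R₂ * D) = 0 := by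
      linear_combination g ^ 2 * (o0 + o1 + o2) + D ^ 2 * o0 - D * g * (2 * o0 + o1)
    have := (mul_eq_zero.1 this).resolve_left (mul_ne_zero hl hne)
    linarith

section OneVariable

variable {k₁ k₂ k₃ b₀ : ℝ} {φ : ℝ → ℝ}

lemma sub_mul_deriv_pos
    (hreg : ∀ ρ s : ℝ, |s| ≤ ρ → ρ < b₀ →
      φ s - s * deriv φ s + (ρ^2 - s^2) * deriv (deriv φ) s > 0)
    {s : ℝ} (hs : s ∈ Set.Ioo (-b₀) b₀) : 0 < φ s - s * deriv φ s := by
  have h := hreg |s| s le_rfl (abs_lt.2 hs)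
  simpa using h

/-- The leading coefficient of the basic ODE stays positive on the regularity interval. -/
lemma ode_coeff_pos (hk' : k₂ ≠ k₁ * k₃) (hb₀ : 0 < b₀)
    (hODE : ∀ s ∈ Set.Ioo (-b₀) b₀,
      (1 + (k₁ + k₃)*s^2 + k₂*s^4) * deriv (deriv φ) s
        = (k₁ + k₂*s^2) * (φ s - s * deriv φ s))
    (hreg : ∀ ρ s : ℝ, |s| ≤ ρ → ρ < b₀ →
      φ s - s * deriv φ s + (ρ^2 - s^2) * deriv (deriv φ) s > 0)
    {t : ℝ} (ht : 0 ≤ t) (ht' : t < b₀ ^ 2) : 0 < 1 + (k₁ + k₃) * t + k₂ * t ^ 2 := by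
  have hne : ∀ t, 0 ≤ t → t < b₀ ^ 2 → 1 + (k₁ + k₃) * t + k₂ * t ^ 2 ≠ 0 := by
    intro t ht ht' h0
    have hs : √t ∈ Set.Ioo (-b₀) b₀ :=
      ⟨by linarith [Real.sqrt_nonneg t], (Real.sqrt_lt' hb₀).2 ht'⟩
    have hf := sub_mul_deriv_pos hreg hs
    have h := hODE _ hs
    have e4 : √t ^ 4 = t ^ 2 := by
      rw [show (4 : ℕ) = 2 * 2 from rfl, pow_mul, Real.sq_sqrt ht]
    rw [e4, Real.sq_sqrt ht, h0, zero_mul, zero_eq_mul, or_iff_left hf.ne'] at h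
    have h1 : 1 + k₃ * t = 0 := by linear_combination h0 - t * h
    apply hk'
    linear_combination k₂ * h1 - k₃ * h
  by_contra! hneg
  have hc : ContinuousOn (fun t : ℝ => 1 + (k₁ + k₃) * t + k₂ * t ^ 2) (Set.Icc 0 t) := by
    fun_prop
  obtain ⟨r, hr, hr0⟩ := intermediate_value_Icc' ht hc
    (show (0 : ℝ) ∈ Set.Icc _ _ from ⟨hneg, by norm_num⟩)
  exact hne r hr.1 (hr.2.trans_lt ht') hr0

lemma hasDerivAt_of_smooth (hφs : ContDiffOn ℝ (⊤ : ℕ∞) φ (Set.Ioo (-b₀) b₀))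
    {s : ℝ} (hs : s ∈ Set.Ioo (-b₀) b₀) :
    HasDerivAt φ (deriv φ s) s ∧ HasDerivAt (deriv φ) (deriv (deriv φ) s) s := by
  have h2 := ((contDiffOn_infty_iff_deriv_of_isOpen isOpen_Ioo).1 hφs)
  exact ⟨((h2.1 s hs).differentiableAt (isOpen_Ioo.mem_nhds hs)).hasDerivAt,
    (((h2.2.differentiableOn (by simp)) s hs).differentiableAt (isOpen_Ioo.mem_nhds hs)).hasDerivAt⟩

/-- The quotient `Q = φ' / (φ - s φ')` satisfies a linear first order ODE. -/
lemma hasDerivAt_Q {s : ℝ} (h1 : HasDerivAt φ (deriv φ s) s)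
    (h2 : HasDerivAt (deriv φ) (deriv (deriv φ) s) s)
    (hf : φ s - s * deriv φ s ≠ 0) (hD : 1 + (k₁ + k₃) * s ^ 2 + k₂ * s ^ 4 ≠ 0)
    (hODE : (1 + (k₁ + k₃)*s^2 + k₂*s^4) * deriv (deriv φ) s
        = (k₁ + k₂*s^2) * (φ s - s * deriv φ s)) :
    HasDerivAt (fun s => deriv φ s / (φ s - s * deriv φ s))
      ((k₁ + k₂ * s ^ 2) / (1 + (k₁ + k₃) * s ^ 2 + k₂ * s ^ 4)
        * (1 + s * (deriv φ s / (φ s - s * deriv φ s)))) s := by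
  have h3 := h2.fun_div (h1.fun_sub ((hasDerivAt_id s).fun_mul h2)) hf
  refine h3.congr_deriv ?_
  generalize deriv (deriv φ) s = p2 at *
  generalize deriv φ s = p1 at *
  generalize φ s = p0 at *
  have e : p2 = (k₁ + k₂ * s ^ 2) / (1 + (k₁ + k₃) * s ^ 2 + k₂ * s ^ 4) * (p0 - s * p1) := by
    rw [div_mul_eq_mul_div, eq_div_iff hD]; linear_combination hODE
  generalize (k₁ + k₂ * s ^ 2) / (1 + (k₁ + k₃) * s ^ 2 + k₂ * s ^ 4) = N at *
  subst e
  simp only [id]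
  generalize hg : p0 - s * p1 = f at *
  field_simp
  ring

end OneVariable

section Composite

variable {E : Type*} [NormedAddCommGroup E] [NormedSpace ℝ E]
  {A β w c : E → ℝ} {A' β' w' c' : E →L[ℝ] ℝ} {e : E} {φ : ℝ → ℝ}

lemma hasFDerivAt_div_sqrt (hA : HasFDerivAt A A' e) (hβ : HasFDerivAt β β' e) (hpos : 0 < A e) :
    HasFDerivAt (fun e => β e / √(A e))
      ((1 / √(A e)) • β' - (β e / (2 * √(A e) ^ 3)) • A') e := by
  have hs : √(A e) ≠ 0 := (Real.sqrt_pos.2 hpos).ne'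
  have h := hβ.fun_mul ((hasDerivAt_inv hs).comp_hasFDerivAt e (hA.sqrt hpos.ne'))
  refine HasFDerivAt.congr_fderiv (f' := _) (by simpa [div_eq_mul_inv] using h) ?_
  ext v
  simp
  field_simp
  ring

lemma hasFDerivAt_alphaBeta (hA : HasFDerivAt A A' e) (hβ : HasFDerivAt β β' e) (hpos : 0 < A e)
    (h1 : HasDerivAt φ (deriv φ (β e / √(A e))) (β e / √(A e))) :
    HasFDerivAt (fun e => √(A e) * φ (β e / √(A e)))
      (((φ (β e / √(A e)) - β e / √(A e) * deriv φ (β e / √(A e))) / (2 * √(A e))) • A'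
        + deriv φ (β e / √(A e)) • β') e := by
  have hs : √(A e) ≠ 0 := (Real.sqrt_pos.2 hpos).ne'
  have h := (hA.sqrt hpos.ne').fun_mul (h1.comp_hasFDerivAt e (hasFDerivAt_div_sqrt hA hβ hpos))
  refine h.congr_fderiv ?_
  ext v
  simp
  field_simp
  ring

lemma hasFDerivAt_vertical (hA : HasFDerivAt A A' e) (hβ : HasFDerivAt β β' e)
    (hw : HasFDerivAt w w' e) (hc : HasFDerivAt c c' e) (hpos : 0 < A e)
    (h1 : HasDerivAt φ (deriv φ (β e / √(A e))) (β e / √(A e)))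
    (h2 : HasDerivAt (deriv φ) (deriv (deriv φ) (β e / √(A e))) (β e / √(A e))) :
    HasFDerivAt (fun e => (φ (β e / √(A e)) - β e / √(A e) * deriv φ (β e / √(A e)))
        * (w e / √(A e)) + deriv φ (β e / √(A e)) * c e)
      ((φ (β e / √(A e)) - β e / √(A e) * deriv φ (β e / √(A e)))
          • ((1 / √(A e)) • w' - (w e / (2 * √(A e) ^ 3)) • A')
        + (deriv (deriv φ) (β e / √(A e)) * (c e - β e / √(A e) * (w e / √(A e))))
          • ((1 / √(A e)) • β' - (β e / (2 * √(A e) ^ 3)) • A')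
        + deriv φ (β e / √(A e)) • c') e := by
  have hs := hasFDerivAt_div_sqrt hA hβ hpos
  have hw' := hasFDerivAt_div_sqrt hA hw hpos
  have hφ1 := h1.comp_hasFDerivAt e hs
  have hφ2 := h2.comp_hasFDerivAt e hs
  have h := ((hφ1.fun_sub (hs.fun_mul hφ2)).fun_mul hw').fun_add (hφ2.fun_mul hc)
  refine h.congr_fderiv ?_
  ext v
  simp
  ring

end Composite

lemma spray_congr {F G : Pt → (Fin 2 → ℝ) → ℝ} {x : Pt} (h : ∀ᶠ x' in nhds x, F x' = G x')
    (i : Fin 2) (y : Fin 2 → ℝ) : spray F i x y = spray G i x y := by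
  have hx : F x = G x := h.self_of_nhds
  have h1 : ∀ l : Fin 2,
      (fun x' => fderiv ℝ (fun y' => (F x' y') ^ 2) y (Pi.single l 1)) =ᶠ[nhds x]
        fun x' => fderiv ℝ (fun y' => (G x' y') ^ 2) y (Pi.single l 1) := fun l => by
    filter_upwards [h] with x' hx'
    rw [hx']
  have h2 : (fun x' => (F x' y) ^ 2) =ᶠ[nhds x] fun x' => (G x' y) ^ 2 := by
    filter_upwards [h] with x' hx'
    rw [hx']
  have hg : gMat F x y = gMat G x y := by
    unfold gMat
    rw [hx]
  unfold spray
  simp only [hg, (h1 _).fderiv_eq, h2.fderiv_eq]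

/-- The deviation of a two-dimensional spray from the direction of `y`, from the vertical
derivatives `(p₀, p₁)` of `F`, the factor `h` of its vertical Hessian and the Hamel defect `η`. -/
lemma spray_wedge_algebra {g : Matrix (Fin 2) (Fin 2) ℝ} {F p₀ p₁ y₀ y₁ h η P E₀ E₁ : ℝ}
    (hF : F ≠ 0) (hh : h ≠ 0) (hE : p₀ * y₀ + p₁ * y₁ = F)
    (h00 : g 0 0 = p₀ * p₀ + F * (h * y₁ ^ 2)) (h01 : g 0 1 = p₀ * p₁ - F * (h * (y₀ * y₁)))
    (h10 : g 1 0 = p₁ * p₀ - F * (h * (y₀ * y₁))) (h11 : g 1 1 = p₁ * p₁ + F * (h * y₀ ^ 2))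
    (hE₀ : E₀ = 2 * F * (η * y₁) + 2 * P * p₀) (hE₁ : E₁ = -(2 * F * (η * y₀)) + 2 * P * p₁) :
    (1 / 4) * (g⁻¹ 0 0 * E₀ + g⁻¹ 0 1 * E₁) * y₁ - (1 / 4) * (g⁻¹ 1 0 * E₀ + g⁻¹ 1 1 * E₁) * y₀
      = η / (2 * h) := by
  have hdet : g.det = F ^ 3 * h := by
    rw [Matrix.det_fin_two, h00, h01, h10, h11]
    linear_combination F * h * (p₀ * y₀ + p₁ * y₁ + F) * hE
  have hinv : g⁻¹ = (F ^ 3 * h)⁻¹ • !![g 1 1, -g 0 1; -g 1 0, g 0 0] := by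
    rw [Matrix.inv_def, hdet, Matrix.adjugate_fin_two, Ring.inverse_eq_inv']
  rw [hinv]
  simp only [Matrix.smul_apply, Matrix.of_apply, Matrix.cons_val', Matrix.cons_val_zero,
    Matrix.cons_val_one, smul_eq_mul, h00, h01, h10, h11, hE₀, hE₁, Matrix.cons_val_fin_one]
  field_simp
  rw [← hE]
  ring

/-- The vertical derivative of `α φ(β/α)`, from the values `q = α²`, `l = β` and half the
derivative `w` of `α²` and the derivative `c` of `β`. -/
def vert (φ : ℝ → ℝ) (q l w c : ℝ) : ℝ :=
  (φ (l / √q) - l / √q * deriv φ (l / √q)) * (w / √q) + deriv φ (l / √q) * c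

/-- The derivative of `vert` from the derivatives `q'`, `l'`, `w'`, `c'` of its arguments. -/
def vertDeriv (φ : ℝ → ℝ) (q l w c q' l' w' c' : ℝ) : ℝ :=
  (φ (l / √q) - l / √q * deriv φ (l / √q)) * (w' / √q - w / (2 * √q ^ 3) * q')
    + deriv (deriv φ) (l / √q) * (c - l / √q * (w / √q)) * (l' / √q - l / (2 * √q ^ 3) * q')
    + deriv φ (l / √q) * c'

section Composite

variable {E : Type*} [NormedAddCommGroup E] [NormedSpace ℝ E]
  {A β w c : E → ℝ} {A' β' w' c' : E →L[ℝ] ℝ} {e : E} {φ : ℝ → ℝ}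

lemma fderiv_alphaBeta_sq (hA : HasFDerivAt A A' e) (hβ : HasFDerivAt β β' e) (hpos : 0 < A e)
    (h1 : HasDerivAt φ (deriv φ (β e / √(A e))) (β e / √(A e))) (v : E) :
    fderiv ℝ (fun e => (√(A e) * φ (β e / √(A e))) ^ 2) e v
      = 2 * (√(A e) * φ (β e / √(A e))) * vert φ (A e) (β e) (A' v / 2) (β' v) := by
  have h := (hasFDerivAt_alphaBeta hA hβ hpos h1).pow 2
  rw [h.fderiv]
  have hs : √(A e) ≠ 0 := (Real.sqrt_pos.2 hpos).ne'
  simp [vert]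
  field_simp

lemma fderiv_mul_vert (hA : HasFDerivAt A A' e) (hβ : HasFDerivAt β β' e)
    (hw : HasFDerivAt w w' e) (hc : HasFDerivAt c c' e) (hpos : 0 < A e)
    (h1 : HasDerivAt φ (deriv φ (β e / √(A e))) (β e / √(A e)))
    (h2 : HasDerivAt (deriv φ) (deriv (deriv φ) (β e / √(A e))) (β e / √(A e))) (v : E) :
    fderiv ℝ (fun e => 2 * (√(A e) * φ (β e / √(A e))) * vert φ (A e) (β e) (w e) (c e)) e v
      = 2 * vert φ (A e) (β e) (A' v / 2) (β' v) * vert φ (A e) (β e) (w e) (c e)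
        + 2 * (√(A e) * φ (β e / √(A e)))
          * vertDeriv φ (A e) (β e) (w e) (c e) (A' v) (β' v) (w' v) (c' v) := by
  have h := ((hasFDerivAt_alphaBeta hA hβ hpos h1).const_mul 2).fun_mul
    (hasFDerivAt_vertical hA hβ hw hc hpos h1 h2)
  have hs : √(A e) ≠ 0 := (Real.sqrt_pos.2 hpos).ne'
  simp only [vert, vertDeriv]
  rw [h.fderiv]
  simp
  field_simp
  ring

end Composite

section Plane

/-- The quadratic form with coefficients `e, f, g`. -/
def qform (e f g : Pt → ℝ) (x y : Pt) : ℝ :=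
  e x * y 0 ^ 2 + 2 * f x * (y 0 * y 1) + g x * y 1 ^ 2

/-- The linear form with coefficients `b, c`. -/
def lform (b c : Pt → ℝ) (x y : Pt) : ℝ := b x * y 0 + c x * y 1

open ContinuousLinearMap in
lemma hasFDerivAt_lform_vertical (b c : Pt → ℝ) (x y : Pt) :
    HasFDerivAt (fun y => lform b c x y) (b x • proj (R := ℝ) (φ := fun _ : Fin 2 => ℝ) 0
      + c x • proj (R := ℝ) (φ := fun _ : Fin 2 => ℝ) 1) y :=
  (b x • proj (R := ℝ) (φ := fun _ : Fin 2 => ℝ) 0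
      + c x • proj (R := ℝ) (φ := fun _ : Fin 2 => ℝ) 1).hasFDerivAt

open ContinuousLinearMap in
lemma hasFDerivAt_qform_vertical (e f g : Pt → ℝ) (x y : Pt) :
    HasFDerivAt (fun y => qform e f g x y)
      ((2 * lform e f x y) • proj (R := ℝ) (φ := fun _ : Fin 2 => ℝ) 0
      + (2 * lform f g x y) • proj (R := ℝ) (φ := fun _ : Fin 2 => ℝ) 1) y := by
  have h0 : HasFDerivAt (fun y : Pt => y 0) (proj (R := ℝ) (φ := fun _ : Fin 2 => ℝ) 0) y :=
    (proj (R := ℝ) (φ := fun _ : Fin 2 => ℝ) 0).hasFDerivAt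
  have h1 : HasFDerivAt (fun y : Pt => y 1) (proj (R := ℝ) (φ := fun _ : Fin 2 => ℝ) 1) y :=
    (proj (R := ℝ) (φ := fun _ : Fin 2 => ℝ) 1).hasFDerivAt
  have h := (((h0.pow 2).const_mul (e x)).fun_add ((h0.fun_mul h1).const_mul (2 * f x))).fun_add
    ((h1.pow 2).const_mul (g x))
  refine HasFDerivAt.congr_fderiv h ?_
  ext v
  simp [lform]
  ring

lemma hasFDerivAt_lform_horizontal {b c : Pt → ℝ} {x : Pt} (hb : DifferentiableAt ℝ b x)
    (hc : DifferentiableAt ℝ c x) (y : Pt) :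
    HasFDerivAt (fun x => lform b c x y) (y 0 • fderiv ℝ b x + y 1 • fderiv ℝ c x) x :=
  (hb.hasFDerivAt.mul_const (y 0)).fun_add (hc.hasFDerivAt.mul_const (y 1))

lemma hasFDerivAt_qform_horizontal {e f g : Pt → ℝ} {x : Pt} (he : DifferentiableAt ℝ e x)
    (hf : DifferentiableAt ℝ f x) (hg : DifferentiableAt ℝ g x) (y : Pt) :
    HasFDerivAt (fun x => qform e f g x y)
      (y 0 ^ 2 • fderiv ℝ e x + (2 * (y 0 * y 1)) • fderiv ℝ f x + y 1 ^ 2 • fderiv ℝ g x) x := by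
  have h := ((he.hasFDerivAt.mul_const (y 0 ^ 2)).fun_add
    ((hf.hasFDerivAt.const_mul 2).mul_const (y 0 * y 1))).fun_add
    (hg.hasFDerivAt.mul_const (y 1 ^ 2))
  refine HasFDerivAt.congr_fderiv h ?_
  ext v
  simp
  ring

/-- The metric `α φ(β/α)` with `α² = e dx² + 2 f dx dy + g dy²` and `β = b dx + c dy`. -/
def abMetric (φ : ℝ → ℝ) (e f g b c : Pt → ℝ) (x y : Pt) : ℝ :=
  √(qform e f g x y) * φ (lform b c x y / √(qform e f g x y))

end Plane

section Pointwise

variable {φ : ℝ → ℝ} {e f g b c y₀ y₁ q l : ℝ}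

/-- The factor `h` of the vertical Hessian `F_{ij} = h (y²)_i^⊥ (y²)_j^⊥` of `α φ(β/α)`. -/
def hessFactor (φ : ℝ → ℝ) (e f g b c y₀ y₁ q l : ℝ) : ℝ :=
  (φ (l / √q) - l / √q * deriv φ (l / √q)) * (e * g - f ^ 2) / √q ^ 3
    + deriv (deriv φ) (l / √q) * (b * (f * y₀ + g * y₁) - c * (e * y₀ + f * y₁)) ^ 2 / √q ^ 5

lemma vert_residual (hq : 0 < q) (hq' : q = e * y₀ ^ 2 + 2 * f * (y₀ * y₁) + g * y₁ ^ 2)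
    (hl : l = b * y₀ + c * y₁) :
    b - l / √q * ((e * y₀ + f * y₁) / √q)
        = (b * (f * y₀ + g * y₁) - c * (e * y₀ + f * y₁)) / √q ^ 2 * y₁
      ∧ c - l / √q * ((f * y₀ + g * y₁) / √q)
        = -((b * (f * y₀ + g * y₁) - c * (e * y₀ + f * y₁)) / √q ^ 2 * y₀) := by
  have hs : √q ≠ 0 := (Real.sqrt_pos.2 hq).ne'
  have hs2 : √q ^ 2 = e * y₀ ^ 2 + 2 * f * (y₀ * y₁) + g * y₁ ^ 2 := by
    rw [Real.sq_sqrt hq.le, hq']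
  subst hl
  constructor
  · field_simp
    linear_combination b * hs2
  · field_simp
    linear_combination c * hs2

lemma vertDeriv_vertical (hq : 0 < q)
    (hq' : q = e * y₀ ^ 2 + 2 * f * (y₀ * y₁) + g * y₁ ^ 2) (hl : l = b * y₀ + c * y₁) :
    vertDeriv φ q l (e * y₀ + f * y₁) b (2 * (e * y₀ + f * y₁)) b e 0
        = hessFactor φ e f g b c y₀ y₁ q l * y₁ ^ 2
      ∧ vertDeriv φ q l (f * y₀ + g * y₁) c (2 * (e * y₀ + f * y₁)) b f 0
        = -(hessFactor φ e f g b c y₀ y₁ q l * (y₀ * y₁))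
      ∧ vertDeriv φ q l (e * y₀ + f * y₁) b (2 * (f * y₀ + g * y₁)) c f 0
        = -(hessFactor φ e f g b c y₀ y₁ q l * (y₀ * y₁))
      ∧ vertDeriv φ q l (f * y₀ + g * y₁) c (2 * (f * y₀ + g * y₁)) c g 0
        = hessFactor φ e f g b c y₀ y₁ q l * y₀ ^ 2 := by
  obtain ⟨h0, h1⟩ := vert_residual hq hq' hl
  have hs : √q ≠ 0 := (Real.sqrt_pos.2 hq).ne'
  have hs2 : √q ^ 2 = e * y₀ ^ 2 + 2 * f * (y₀ * y₁) + g * y₁ ^ 2 := by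
    rw [Real.sq_sqrt hq.le, hq']
  have t0 : b / √q - l / (2 * √q ^ 3) * (2 * (e * y₀ + f * y₁))
      = (b * (f * y₀ + g * y₁) - c * (e * y₀ + f * y₁)) / √q ^ 3 * y₁ := by
    rw [show b / √q - l / (2 * √q ^ 3) * (2 * (e * y₀ + f * y₁)) =
      (b - l / √q * ((e * y₀ + f * y₁) / √q)) / √q by field_simp, h0]
    field_simp
  have t1 : c / √q - l / (2 * √q ^ 3) * (2 * (f * y₀ + g * y₁))
      = -((b * (f * y₀ + g * y₁) - c * (e * y₀ + f * y₁)) / √q ^ 3 * y₀) := by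
    rw [show c / √q - l / (2 * √q ^ 3) * (2 * (f * y₀ + g * y₁)) =
      (c - l / √q * ((f * y₀ + g * y₁) / √q)) / √q by field_simp, h1]
    field_simp
  have q00 : e / √q - (e * y₀ + f * y₁) / (2 * √q ^ 3) * (2 * (e * y₀ + f * y₁))
      = (e * g - f ^ 2) / √q ^ 3 * y₁ ^ 2 := by
    field_simp
    linear_combination e * hs2
  have q01 : f / √q - (f * y₀ + g * y₁) / (2 * √q ^ 3) * (2 * (e * y₀ + f * y₁))
      = -((e * g - f ^ 2) / √q ^ 3 * (y₀ * y₁)) := by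
    field_simp
    linear_combination f * hs2
  have q10 : f / √q - (e * y₀ + f * y₁) / (2 * √q ^ 3) * (2 * (f * y₀ + g * y₁))
      = -((e * g - f ^ 2) / √q ^ 3 * (y₀ * y₁)) := by
    field_simp
    linear_combination f * hs2
  have q11 : g / √q - (f * y₀ + g * y₁) / (2 * √q ^ 3) * (2 * (f * y₀ + g * y₁))
      = (e * g - f ^ 2) / √q ^ 3 * y₀ ^ 2 := by
    field_simp
    linear_combination g * hs2
  unfold vertDeriv hessFactor
  refine ⟨?_, ?_, ?_, ?_⟩
  · rw [h0, t0, q00]; field_simp; ring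
  · rw [h1, t0, q01]; field_simp; ring
  · rw [h0, t1, q10]; field_simp; ring
  · rw [h1, t1, q11]; field_simp; ring

lemma vert_euler (hq : 0 < q) (hq' : q = e * y₀ ^ 2 + 2 * f * (y₀ * y₁) + g * y₁ ^ 2)
    (hl : l = b * y₀ + c * y₁) :
    vert φ q l (e * y₀ + f * y₁) b * y₀ + vert φ q l (f * y₀ + g * y₁) c * y₁
      = √q * φ (l / √q) := by
  have hs : √q ≠ 0 := (Real.sqrt_pos.2 hq).ne'
  have hs2 : √q ^ 2 = e * y₀ ^ 2 + 2 * f * (y₀ * y₁) + g * y₁ ^ 2 := by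
    rw [Real.sq_sqrt hq.le, hq']
  have e1 : (e * y₀ + f * y₁) / √q * y₀ + (f * y₀ + g * y₁) / √q * y₁ = √q := by
    field_simp
    linear_combination -hs2
  have e2 : l / √q * √q = l := by field_simp
  unfold vert
  generalize l / √q = s at *
  linear_combination (φ s - s * deriv φ s) * e1 - deriv φ s * e2 - deriv φ s * hl

lemma vertDeriv_euler {q' l' e' f' g' b' c' : ℝ} (hq : 0 < q)
    (hq' : q = e * y₀ ^ 2 + 2 * f * (y₀ * y₁) + g * y₁ ^ 2) (hl : l = b * y₀ + c * y₁)
    (hq'' : q' = e' * y₀ ^ 2 + 2 * f' * (y₀ * y₁) + g' * y₁ ^ 2) (hl' : l' = b' * y₀ + c' * y₁) :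
    vertDeriv φ q l (e * y₀ + f * y₁) b q' l' (e' * y₀ + f' * y₁) b' * y₀
      + vertDeriv φ q l (f * y₀ + g * y₁) c q' l' (f' * y₀ + g' * y₁) c' * y₁
      = vert φ q l (q' / 2) l' := by
  obtain ⟨h0, h1⟩ := vert_residual hq hq' hl
  have hs : √q ≠ 0 := (Real.sqrt_pos.2 hq).ne'
  have hs2 : √q ^ 2 = e * y₀ ^ 2 + 2 * f * (y₀ * y₁) + g * y₁ ^ 2 := by
    rw [Real.sq_sqrt hq.le, hq']
  have e1 : ((e' * y₀ + f' * y₁) / √q - (e * y₀ + f * y₁) / (2 * √q ^ 3) * q') * y₀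
      + ((f' * y₀ + g' * y₁) / √q - (f * y₀ + g * y₁) / (2 * √q ^ 3) * q') * y₁
      = q' / 2 / √q := by
    field_simp
    linear_combination -2 * √q ^ 2 * hq'' + q' * hs2
  unfold vertDeriv vert
  rw [h0, h1]
  generalize l / √q = s at *
  linear_combination (φ s - s * deriv φ s) * e1 - deriv φ s * hl'

end Pointwise

section Plane

open Filter Topology

variable {φ : ℝ → ℝ} {b₀ : ℝ} {U : Set Pt} {e f g b c : Pt → ℝ}

lemma fderiv_abMetric_sq (h1 : ∀ s ∈ Set.Ioo (-b₀) b₀, HasDerivAt φ (deriv φ s) s) {x y : Pt}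
    (hq : 0 < qform e f g x y)
    (hs : lform b c x y / √(qform e f g x y) ∈ Set.Ioo (-b₀) b₀) :
    fderiv ℝ (fun y => (abMetric φ e f g b c x y) ^ 2) y (Pi.single 0 1)
        = 2 * abMetric φ e f g b c x y
          * vert φ (qform e f g x y) (lform b c x y) (lform e f x y) (b x)
      ∧ fderiv ℝ (fun y => (abMetric φ e f g b c x y) ^ 2) y (Pi.single 1 1)
        = 2 * abMetric φ e f g b c x y
          * vert φ (qform e f g x y) (lform b c x y) (lform f g x y) (c x) := by
  have h := fderiv_alphaBeta_sq (hasFDerivAt_qform_vertical e f g x y)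
    (hasFDerivAt_lform_vertical b c x y) hq (h1 _ hs)
  constructor
  · simpa [abMetric] using h (Pi.single 0 1)
  · simpa [abMetric] using h (Pi.single 1 1)

lemma gMat_abMetric (h1 : ∀ s ∈ Set.Ioo (-b₀) b₀, HasDerivAt φ (deriv φ s) s)
    (h2 : ∀ s ∈ Set.Ioo (-b₀) b₀, HasDerivAt (deriv φ) (deriv (deriv φ) s) s) {x y : Pt}
    (hq : ∀ y, y ≠ 0 → 0 < qform e f g x y)
    (hs : ∀ y, y ≠ 0 → lform b c x y / √(qform e f g x y) ∈ Set.Ioo (-b₀) b₀) (hy : y ≠ 0) :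
    gMat (abMetric φ e f g b c) x y 0 0
        = vert φ (qform e f g x y) (lform b c x y) (lform e f x y) (b x)
            * vert φ (qform e f g x y) (lform b c x y) (lform e f x y) (b x)
          + abMetric φ e f g b c x y * (hessFactor φ (e x) (f x) (g x) (b x) (c x) (y 0) (y 1)
            (qform e f g x y) (lform b c x y) * y 1 ^ 2)
      ∧ gMat (abMetric φ e f g b c) x y 0 1
        = vert φ (qform e f g x y) (lform b c x y) (lform e f x y) (b x)
            * vert φ (qform e f g x y) (lform b c x y) (lform f g x y) (c x)
          - abMetric φ e f g b c x y * (hessFactor φ (e x) (f x) (g x) (b x) (c x) (y 0) (y 1)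
            (qform e f g x y) (lform b c x y) * (y 0 * y 1))
      ∧ gMat (abMetric φ e f g b c) x y 1 0
        = vert φ (qform e f g x y) (lform b c x y) (lform f g x y) (c x)
            * vert φ (qform e f g x y) (lform b c x y) (lform e f x y) (b x)
          - abMetric φ e f g b c x y * (hessFactor φ (e x) (f x) (g x) (b x) (c x) (y 0) (y 1)
            (qform e f g x y) (lform b c x y) * (y 0 * y 1))
      ∧ gMat (abMetric φ e f g b c) x y 1 1
        = vert φ (qform e f g x y) (lform b c x y) (lform f g x y) (c x)
            * vert φ (qform e f g x y) (lform b c x y) (lform f g x y) (c x)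
          + abMetric φ e f g b c x y * (hessFactor φ (e x) (f x) (g x) (b x) (c x) (y 0) (y 1)
            (qform e f g x y) (lform b c x y) * y 0 ^ 2) := by
  have hev0 : (fun y => fderiv ℝ (fun y => (abMetric φ e f g b c x y) ^ 2) y (Pi.single 0 1))
      =ᶠ[𝓝 y] fun y => 2 * abMetric φ e f g b c x y
          * vert φ (qform e f g x y) (lform b c x y) (lform e f x y) (b x) := by
    filter_upwards [isOpen_ne.mem_nhds hy] with y' hy'
    exact (fderiv_abMetric_sq h1 (hq _ hy') (hs _ hy')).1
  have hev1 : (fun y => fderiv ℝ (fun y => (abMetric φ e f g b c x y) ^ 2) y (Pi.single 1 1))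
      =ᶠ[𝓝 y] fun y => 2 * abMetric φ e f g b c x y
          * vert φ (qform e f g x y) (lform b c x y) (lform f g x y) (c x) := by
    filter_upwards [isOpen_ne.mem_nhds hy] with y' hy'
    exact (fderiv_abMetric_sq h1 (hq _ hy') (hs _ hy')).2
  have d0 := fderiv_mul_vert (hasFDerivAt_qform_vertical e f g x y)
    (hasFDerivAt_lform_vertical b c x y) (hasFDerivAt_lform_vertical e f x y)
    (hasFDerivAt_const (b x) y) (hq y hy) (h1 _ (hs y hy)) (h2 _ (hs y hy))
  have d1 := fderiv_mul_vert (hasFDerivAt_qform_vertical e f g x y)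
    (hasFDerivAt_lform_vertical b c x y) (hasFDerivAt_lform_vertical f g x y)
    (hasFDerivAt_const (c x) y) (hq y hy) (h1 _ (hs y hy)) (h2 _ (hs y hy))
  obtain ⟨v00, v01, v10, v11⟩ := vertDeriv_vertical (φ := φ) (e := e x) (f := f x) (g := g x)
    (b := b x) (c := c x) (y₀ := y 0) (y₁ := y 1) (q := qform e f g x y) (l := lform b c x y)
    (hq y hy) rfl rfl
  have d00 := d0 (Pi.single 0 1)
  have d10 := d0 (Pi.single 1 1)
  have d01 := d1 (Pi.single 0 1)
  have d11 := d1 (Pi.single 1 1)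
  simp at d00 d01 d10 d11
  change vertDeriv φ _ _ (lform e f x y) _ (2 * lform e f x y) _ _ _ = _ at v00
  change vertDeriv φ _ _ (lform f g x y) _ (2 * lform e f x y) _ _ _ = _ at v01
  change vertDeriv φ _ _ (lform e f x y) _ (2 * lform f g x y) _ _ _ = _ at v10
  change vertDeriv φ _ _ (lform f g x y) _ (2 * lform f g x y) _ _ _ = _ at v11
  unfold gMat
  simp only [Matrix.of_apply]
  rw [hev0.fderiv_eq, hev1.fderiv_eq]
  refine ⟨?_, ?_, ?_, ?_⟩
  · refine (congrArg (1 / 2 * ·) d00).trans ?_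
    rw [← v00]; simp only [abMetric]; ring
  · refine (congrArg (1 / 2 * ·) d01).trans ?_
    rw [sub_eq_add_neg, ← mul_neg, ← v01]; simp only [abMetric]; ring
  · refine (congrArg (1 / 2 * ·) d10).trans ?_
    rw [sub_eq_add_neg, ← mul_neg, ← v10]; simp only [abMetric]; ring
  · refine (congrArg (1 / 2 * ·) d11).trans ?_
    rw [← v11]; simp only [abMetric]; ring

end Plane

section Plane

open Filter Topology

variable {φ : ℝ → ℝ} {b₀ : ℝ} {U : Set Pt} {e f g b c : Pt → ℝ}

/-- The derivative in the direction `k` of the vertical derivative of `abMetric`; `w₀, w₁` are the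
coefficients of half the vertical derivative of `α²` and `b₁` that of `β`. -/
def mixedDeriv (φ : ℝ → ℝ) (e f g b c w₀ w₁ b₁ : Pt → ℝ) (k : Fin 2) (x y : Pt) : ℝ :=
  vertDeriv φ (qform e f g x y) (lform b c x y) (lform w₀ w₁ x y) (b₁ x)
    (qform (pd e k) (pd f k) (pd g k) x y) (lform (pd b k) (pd c k) x y)
    (lform (pd w₀ k) (pd w₁ k) x y) (pd b₁ k x)

lemma fderiv_fderiv_abMetric_sq
    (h1 : ∀ s ∈ Set.Ioo (-b₀) b₀, HasDerivAt φ (deriv φ s) s)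
    (h2 : ∀ s ∈ Set.Ioo (-b₀) b₀, HasDerivAt (deriv φ) (deriv (deriv φ) s) s) {x y : Pt}
    (hU : U ∈ 𝓝 x)
    (he : DifferentiableAt ℝ e x) (hf : DifferentiableAt ℝ f x) (hg : DifferentiableAt ℝ g x)
    (hb : DifferentiableAt ℝ b x) (hc : DifferentiableAt ℝ c x)
    (hq : ∀ x ∈ U, 0 < qform e f g x y)
    (hs : ∀ x ∈ U, lform b c x y / √(qform e f g x y) ∈ Set.Ioo (-b₀) b₀) (k : Fin 2) :
    fderiv ℝ (fun x => (abMetric φ e f g b c x y) ^ 2) x (Pi.single k 1)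
        = 2 * abMetric φ e f g b c x y * vert φ (qform e f g x y) (lform b c x y)
          (qform (pd e k) (pd f k) (pd g k) x y / 2) (lform (pd b k) (pd c k) x y)
      ∧ fderiv ℝ (fun x => fderiv ℝ (fun y => (abMetric φ e f g b c x y) ^ 2) y (Pi.single 0 1))
          x (Pi.single k 1)
        = 2 * vert φ (qform e f g x y) (lform b c x y)
            (qform (pd e k) (pd f k) (pd g k) x y / 2) (lform (pd b k) (pd c k) x y)
            * vert φ (qform e f g x y) (lform b c x y) (lform e f x y) (b x)
          + 2 * abMetric φ e f g b c x y * mixedDeriv φ e f g b c e f b k x y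
      ∧ fderiv ℝ (fun x => fderiv ℝ (fun y => (abMetric φ e f g b c x y) ^ 2) y (Pi.single 1 1))
          x (Pi.single k 1)
        = 2 * vert φ (qform e f g x y) (lform b c x y)
            (qform (pd e k) (pd f k) (pd g k) x y / 2) (lform (pd b k) (pd c k) x y)
            * vert φ (qform e f g x y) (lform b c x y) (lform f g x y) (c x)
          + 2 * abMetric φ e f g b c x y * mixedDeriv φ e f g b c f g c k x y := by
  have hev0 : (fun x => fderiv ℝ (fun y => (abMetric φ e f g b c x y) ^ 2) y (Pi.single 0 1))
      =ᶠ[𝓝 x] fun x => 2 * abMetric φ e f g b c x y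
          * vert φ (qform e f g x y) (lform b c x y) (lform e f x y) (b x) := by
    filter_upwards [hU] with x' hx'
    exact (fderiv_abMetric_sq h1 (hq _ hx') (hs _ hx')).1
  have hev1 : (fun x => fderiv ℝ (fun y => (abMetric φ e f g b c x y) ^ 2) y (Pi.single 1 1))
      =ᶠ[𝓝 x] fun x => 2 * abMetric φ e f g b c x y
          * vert φ (qform e f g x y) (lform b c x y) (lform f g x y) (c x) := by
    filter_upwards [hU] with x' hx'
    exact (fderiv_abMetric_sq h1 (hq _ hx') (hs _ hx')).2
  have hx := mem_of_mem_nhds hU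
  have hdq : (y 0 ^ 2 • fderiv ℝ e x + (2 * (y 0 * y 1)) • fderiv ℝ f x + y 1 ^ 2 • fderiv ℝ g x)
      (Pi.single k 1) = qform (pd e k) (pd f k) (pd g k) x y := by
    simp [qform, pd]
    ring
  have hdl : ∀ b c : Pt → ℝ, (y 0 • fderiv ℝ b x + y 1 • fderiv ℝ c x) (Pi.single k 1)
      = lform (pd b k) (pd c k) x y := fun b c => by
    simp [lform, pd]
    ring
  have d := fderiv_alphaBeta_sq (hasFDerivAt_qform_horizontal he hf hg y)
    (hasFDerivAt_lform_horizontal hb hc y) (hq x hx) (h1 _ (hs x hx)) (Pi.single k 1)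
  have d0 := fderiv_mul_vert (hasFDerivAt_qform_horizontal he hf hg y)
    (hasFDerivAt_lform_horizontal hb hc y) (hasFDerivAt_lform_horizontal he hf y)
    hb.hasFDerivAt (hq x hx) (h1 _ (hs x hx)) (h2 _ (hs x hx)) (Pi.single k 1)
  have d1 := fderiv_mul_vert (hasFDerivAt_qform_horizontal he hf hg y)
    (hasFDerivAt_lform_horizontal hb hc y) (hasFDerivAt_lform_horizontal hf hg y)
    hc.hasFDerivAt (hq x hx) (h1 _ (hs x hx)) (h2 _ (hs x hx)) (Pi.single k 1)
  rw [hdq, hdl] at d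
  rw [hdq, hdl, hdl] at d0 d1
  rw [hev0.fderiv_eq, hev1.fderiv_eq]
  exact ⟨d, d0, d1⟩

/-- The deviation of the spray of `α φ(β/α)` from the direction of `y`. -/
lemma spray_abMetric_wedge
    (h1 : ∀ s ∈ Set.Ioo (-b₀) b₀, HasDerivAt φ (deriv φ s) s)
    (h2 : ∀ s ∈ Set.Ioo (-b₀) b₀, HasDerivAt (deriv φ) (deriv (deriv φ) s) s)
    (hφ : ∀ s ∈ Set.Ioo (-b₀) b₀, 0 < φ s) {x y : Pt} (hy : y ≠ 0) (hU : U ∈ 𝓝 x)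
    (he : DifferentiableAt ℝ e x) (hf : DifferentiableAt ℝ f x) (hg : DifferentiableAt ℝ g x)
    (hb : DifferentiableAt ℝ b x) (hc : DifferentiableAt ℝ c x)
    (hq : ∀ x ∈ U, ∀ y, y ≠ 0 → 0 < qform e f g x y)
    (hs : ∀ x ∈ U, ∀ y, y ≠ 0 → lform b c x y / √(qform e f g x y) ∈ Set.Ioo (-b₀) b₀)
    (hh : hessFactor φ (e x) (f x) (g x) (b x) (c x) (y 0) (y 1)
      (qform e f g x y) (lform b c x y) ≠ 0) :
    spray (abMetric φ e f g b c) 0 x y * y 1 - spray (abMetric φ e f g b c) 1 x y * y 0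
      = (mixedDeriv φ e f g b c e f b 1 x y - mixedDeriv φ e f g b c f g c 0 x y)
        / (2 * hessFactor φ (e x) (f x) (g x) (b x) (c x) (y 0) (y 1)
          (qform e f g x y) (lform b c x y)) := by
  have hx := mem_of_mem_nhds hU
  have hD := fderiv_fderiv_abMetric_sq h1 h2 hU he hf hg hb hc (fun x hx => hq x hx y hy)
    (fun x hx => hs x hx y hy)
  obtain ⟨p0, a00, a10⟩ := hD 0
  obtain ⟨p1, a01, a11⟩ := hD 1
  obtain ⟨g00, g01, g10, g11⟩ := gMat_abMetric h1 h2 (hq x hx) (hs x hx) hy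
  have hq0 := hq x hx y hy
  have hF : abMetric φ e f g b c x y ≠ 0 :=
    (mul_pos (Real.sqrt_pos.2 hq0) (hφ _ (hs x hx y hy))).ne'
  have hE : vert φ (qform e f g x y) (lform b c x y) (lform e f x y) (b x) * y 0
      + vert φ (qform e f g x y) (lform b c x y) (lform f g x y) (c x) * y 1
      = abMetric φ e f g b c x y := vert_euler (φ := φ) (e := e x) (f := f x) (g := g x) (b := b x) (c := c x)
    (y₀ := y 0) (y₁ := y 1) (q := qform e f g x y) (l := lform b c x y) hq0 rfl rfl
  have hE' : ∀ k, mixedDeriv φ e f g b c e f b k x y * y 0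
      + mixedDeriv φ e f g b c f g c k x y * y 1 = vert φ (qform e f g x y) (lform b c x y)
          (qform (pd e k) (pd f k) (pd g k) x y / 2) (lform (pd b k) (pd c k) x y) := fun k =>
    vertDeriv_euler (φ := φ) (e := e x) (f := f x) (g := g x) (b := b x) (c := c x)
      (y₀ := y 0) (y₁ := y 1) (q := qform e f g x y) (l := lform b c x y) hq0 rfl rfl rfl rfl
  unfold spray
  simp only [Fin.sum_univ_two]
  refine spray_wedge_algebra (P := vert φ (qform e f g x y) (lform b c x y)
      (qform (pd e 0) (pd f 0) (pd g 0) x y / 2) (lform (pd b 0) (pd c 0) x y) * y 0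
      + vert φ (qform e f g x y) (lform b c x y)
      (qform (pd e 1) (pd f 1) (pd g 1) x y / 2) (lform (pd b 1) (pd c 1) x y) * y 1)
    hF hh hE g00 g01 g10 g11 ?_ ?_
  · rw [a00, a01, p0]
    linear_combination 2 * abMetric φ e f g b c x y * hE' 0
  · rw [a10, a11, p1]
    linear_combination 2 * abMetric φ e f g b c x y * hE' 1

end Plane

section Pointwise

variable {φ : ℝ → ℝ} {e f g b c y₀ y₁ q l B : ℝ}

lemma hessFactor_eq (hq : 0 < q)
    (hB : (e * g - f ^ 2) * B = g * b ^ 2 - 2 * f * b * c + e * c ^ 2)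
    (hq' : q = e * y₀ ^ 2 + 2 * f * (y₀ * y₁) + g * y₁ ^ 2) (hl : l = b * y₀ + c * y₁) :
    hessFactor φ e f g b c y₀ y₁ q l = (e * g - f ^ 2) / √q ^ 3
      * (φ (l / √q) - l / √q * deriv φ (l / √q)
        + (B - (l / √q) ^ 2) * deriv (deriv φ) (l / √q)) := by
  have hs : √q ≠ 0 := (Real.sqrt_pos.2 hq).ne'
  have hs2 : √q ^ 2 = q := Real.sq_sqrt hq.le
  have hκ : (b * (f * y₀ + g * y₁) - c * (e * y₀ + f * y₁)) ^ 2
      = (e * g - f ^ 2) * (B * √q ^ 2 - l ^ 2) := by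
    rw [hs2, hl]
    linear_combination -q * hB - (g * b ^ 2 - 2 * f * b * c + e * c ^ 2) * hq'
  unfold hessFactor
  rw [hκ]
  generalize φ (l / √q) - l / √q * deriv φ (l / √q) = F₀
  generalize deriv (deriv φ) (l / √q) = F₂
  field_simp

lemma sq_lform_le (hq : 0 < q) (hΔ : 0 < e * g - f ^ 2)
    (hB : (e * g - f ^ 2) * B = g * b ^ 2 - 2 * f * b * c + e * c ^ 2)
    (hq' : q = e * y₀ ^ 2 + 2 * f * (y₀ * y₁) + g * y₁ ^ 2) (hl : l = b * y₀ + c * y₁) :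
    (l / √q) ^ 2 ≤ B := by
  have hκ : (b * (f * y₀ + g * y₁) - c * (e * y₀ + f * y₁)) ^ 2
      = (e * g - f ^ 2) * (B * q - l ^ 2) := by
    rw [hl]
    linear_combination -q * hB - (g * b ^ 2 - 2 * f * b * c + e * c ^ 2) * hq'
  rw [div_pow, Real.sq_sqrt hq.le, div_le_iff₀ hq]
  nlinarith [sq_nonneg (b * (f * y₀ + g * y₁) - c * (e * y₀ + f * y₁))]

variable {e₀ e₁ f₀ f₁ g₀ g₁ b₀ b₁ c₀ c₁ : ℝ}

/-- The Hamel defect of `α φ(β/α)` in terms of the Hamel defect of `α`, the symmetrized covariant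
derivative of `β` and `dβ`. -/
lemma vertDeriv_sub_vertDeriv (hq : 0 < q) (hΔ : 0 < e * g - f ^ 2)
    (hq' : q = e * y₀ ^ 2 + 2 * f * (y₀ * y₁) + g * y₁ ^ 2) (hl : l = b * y₀ + c * y₁)
    {Γ κ R w : ℝ}
    (hΓ : Γ = q * ((e₁ * y₀ + f₁ * y₁) - (f₀ * y₀ + g₀ * y₁))
      - ((e * y₀ + f * y₁) * (e₁ * y₀ ^ 2 + 2 * f₁ * (y₀ * y₁) + g₁ * y₁ ^ 2)
        - (f * y₀ + g * y₁) * (e₀ * y₀ ^ 2 + 2 * f₀ * (y₀ * y₁) + g₀ * y₁ ^ 2)) / 2)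
    (hκ : κ = b * (f * y₀ + g * y₁) - c * (e * y₀ + f * y₁))
    (hR : R = ((e * g - f ^ 2) * b₀ - (b * g - c * f) * (e₀ / 2)
          - (c * e - b * f) * (f₀ - e₁ / 2)) * y₀ ^ 2
        + ((e * g - f ^ 2) * (c₀ + b₁) - (b * g - c * f) * e₁ - (c * e - b * f) * g₀) * (y₀ * y₁)
        + ((e * g - f ^ 2) * c₁ - (b * g - c * f) * (f₁ - g₀ / 2)
          - (c * e - b * f) * (g₁ / 2)) * y₁ ^ 2)
    (hw : w = b₁ - c₀) :
    vertDeriv φ q l (e * y₀ + f * y₁) b (e₁ * y₀ ^ 2 + 2 * f₁ * (y₀ * y₁) + g₁ * y₁ ^ 2)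
        (b₁ * y₀ + c₁ * y₁) (e₁ * y₀ + f₁ * y₁) b₁
      - vertDeriv φ q l (f * y₀ + g * y₁) c (e₀ * y₀ ^ 2 + 2 * f₀ * (y₀ * y₁) + g₀ * y₁ ^ 2)
        (b₀ * y₀ + c₀ * y₁) (f₀ * y₀ + g₀ * y₁) c₀
      = ((φ (l / √q) - l / √q * deriv φ (l / √q)) * Γ
        + deriv (deriv φ) (l / √q) * κ * (R / (e * g - f ^ 2) + κ * Γ / (q * (e * g - f ^ 2)))
        + deriv φ (l / √q) * w * √q ^ 3) / √q ^ 3 := by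
  obtain ⟨h0, h1⟩ := vert_residual hq hq' hl
  have hs : √q ≠ 0 := (Real.sqrt_pos.2 hq).ne'
  have hs2 : √q ^ 2 = q := Real.sq_sqrt hq.le
  have hid : (e * g - f ^ 2) * (q * ((b₁ * y₀ + c₁ * y₁) * y₁ + (b₀ * y₀ + c₀ * y₁) * y₀)
      - l * ((e₁ * y₀ ^ 2 + 2 * f₁ * (y₀ * y₁) + g₁ * y₁ ^ 2) * y₁
        + (e₀ * y₀ ^ 2 + 2 * f₀ * (y₀ * y₁) + g₀ * y₁ ^ 2) * y₀) / 2) = q * R + κ * Γ := by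
    rw [hR, hκ, hΓ, hq', hl]
    ring
  have hid' : R / (e * g - f ^ 2) + κ * Γ / (q * (e * g - f ^ 2))
      = ((b₁ * y₀ + c₁ * y₁) * y₁ + (b₀ * y₀ + c₀ * y₁) * y₀)
      - l * ((e₁ * y₀ ^ 2 + 2 * f₁ * (y₀ * y₁) + g₁ * y₁ ^ 2) * y₁
        + (e₀ * y₀ ^ 2 + 2 * f₀ * (y₀ * y₁) + g₀ * y₁ ^ 2) * y₀) / (2 * √q ^ 2) := by
    rw [hs2]
    have hΔ' := hΔ.ne'
    field_simp
    linear_combination -2 * hid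
  unfold vertDeriv
  rw [hid', h0, h1, hΓ, hw, ← hκ, ← hs2]
  generalize φ (l / √√q ^ 2) - l / √√q ^ 2 * deriv φ (l / √√q ^ 2) = F₀
  generalize deriv φ (l / √√q ^ 2) = F₁
  generalize deriv (deriv φ) (l / √√q ^ 2) = F₂
  rw [Real.sqrt_sq (Real.sqrt_nonneg q)]
  generalize √q = r at *
  field_simp
  ring

end Pointwise

section Pointwise

variable {φ : ℝ → ℝ} {e f g b c y₀ y₁ q l B : ℝ}

lemma hamel_defect_identity {k₁ k₂ k₃ Γ κ R w C η Δ : ℝ} (hq : 0 < q) (hΔ : 0 < Δ)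
    (hκ : κ ^ 2 = Δ * (B * q - l ^ 2))
    (hf : 0 < φ (l / √q) - l / √q * deriv φ (l / √q))
    (hODE : (1 + (k₁ + k₃) * (l / √q) ^ 2 + k₂ * (l / √q) ^ 4) * deriv (deriv φ) (l / √q)
        = (k₁ + k₂ * (l / √q) ^ 2) * (φ (l / √q) - l / √q * deriv φ (l / √q)))
    (hη : η = ((φ (l / √q) - l / √q * deriv φ (l / √q)) * Γ
        + deriv (deriv φ) (l / √q) * κ * (R / Δ + κ * Γ / (q * Δ))
        + deriv φ (l / √q) * w * √q ^ 3) / √q ^ 3)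
    (hη' : η = C * (2 * (Δ / √q ^ 3 * (φ (l / √q) - l / √q * deriv φ (l / √q)
        + (B - (l / √q) ^ 2) * deriv (deriv φ) (l / √q))))) :
    (1 + k₁ * B + (k₃ + k₂ * B) * (l / √q) ^ 2) * (2 * Δ * C - Γ)
      = (k₁ + k₂ * (l / √q) ^ 2) * κ * R / Δ
        + deriv φ (l / √q) / (φ (l / √q) - l / √q * deriv φ (l / √q))
          * (1 + (k₁ + k₃) * (l / √q) ^ 2 + k₂ * (l / √q) ^ 4) * w * √q ^ 3 := by
  have hs : √q ≠ 0 := (Real.sqrt_pos.2 hq).ne'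
  have hs2 : (l / √q) ^ 2 * q = l ^ 2 := by
    rw [div_pow, Real.sq_sqrt hq.le]
    field_simp
  have hκ' : κ * (κ * Γ / (q * Δ)) = (B - (l / √q) ^ 2) * Γ := by
    generalize l / √q = s at hs2 ⊢
    field_simp
    linear_combination Γ * hκ + Γ * Δ * hs2
  have hκR : κ * (R / Δ) = κ * R / Δ := by ring
  rw [mul_assoc _ κ, mul_add κ, hκ', hκR] at hη
  rw [mul_assoc _ κ R, mul_div_assoc]
  rw [hη] at hη'
  generalize l / √q = s at *
  generalize κ * R / Δ = K at *
  generalize √q = r at *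
  generalize deriv (deriv φ) s = F₂ at *
  generalize deriv φ s = F₁ at *
  generalize φ s - s * F₁ = F₀ at *
  field_simp at hη' ⊢
  linear_combination -(1 + (k₁ + k₃) * s ^ 2 + k₂ * s ^ 4) * hη'
    + (K + (B - s ^ 2) * Γ - 2 * C * Δ * (B - s ^ 2)) * hODE

lemma exists_cubic_comp (M₀ M₁ M₂ M₃ a₀ a₁ d₀ d₁ : ℝ) : ∃ m₀ m₁ m₂ m₃ : ℝ, ∀ p q : ℝ,
    M₀ * (p * a₀ + q * d₀) ^ 3 + M₁ * (p * a₀ + q * d₀) ^ 2 * (p * a₁ + q * d₁)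
      + M₂ * (p * a₀ + q * d₀) * (p * a₁ + q * d₁) ^ 2 + M₃ * (p * a₁ + q * d₁) ^ 3
    = m₀ * p ^ 3 + m₁ * p ^ 2 * q + m₂ * p * q ^ 2 + m₃ * q ^ 3 :=
  ⟨M₀ * a₀ ^ 3 + M₁ * a₀ ^ 2 * a₁ + M₂ * a₀ * a₁ ^ 2 + M₃ * a₁ ^ 3,
    3 * M₀ * a₀ ^ 2 * d₀ + M₁ * (2 * a₀ * d₀ * a₁ + a₀ ^ 2 * d₁)
      + M₂ * (d₀ * a₁ ^ 2 + 2 * a₀ * a₁ * d₁) + 3 * M₃ * a₁ ^ 2 * d₁,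
    3 * M₀ * a₀ * d₀ ^ 2 + M₁ * (d₀ ^ 2 * a₁ + 2 * a₀ * d₀ * d₁)
      + M₂ * (2 * d₀ * a₁ * d₁ + a₀ * d₁ ^ 2) + 3 * M₃ * a₁ * d₁ ^ 2,
    M₀ * d₀ ^ 3 + M₁ * d₀ ^ 2 * d₁ + M₂ * d₀ * d₁ ^ 2 + M₃ * d₁ ^ 3, fun p q => by ring⟩

variable {e₀ e₁ f₀ f₁ g₀ g₁ b₀ b₁ c₀ c₁ k₁ k₂ k₃ ρ₀ C₀ C₁ C₂ C₃ rA rB rC : ℝ}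

/-- The Douglas condition at a point: `dβ` vanishes there, and the symmetrized covariant
derivative of `β` is diagonal in the frame adapted to `β`, with prescribed ratio of its entries. -/
lemma douglas_pointwise (hΔ : 0 < e * g - f ^ 2) (hBpos : 0 < B)
    (hB : (e * g - f ^ 2) * B = g * b ^ 2 - 2 * f * b * c + e * c ^ 2) (hρ₀ : 0 < ρ₀)
    (hBρ : B < ρ₀ ^ 2)
    (hk : k₂ ≠ (2 * k₁ + 3 * k₃) * (3 * k₁ + 2 * k₃) / 25) (hk' : k₂ ≠ k₁ * k₃)
    (hφs : ContDiffOn ℝ (⊤ : ℕ∞) φ (Set.Ioo (-ρ₀) ρ₀))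
    (hODE : ∀ s ∈ Set.Ioo (-ρ₀) ρ₀,
      (1 + (k₁ + k₃)*s^2 + k₂*s^4) * deriv (deriv φ) s
        = (k₁ + k₂*s^2) * (φ s - s * deriv φ s))
    (hreg : ∀ ρ s : ℝ, |s| ≤ ρ → ρ < ρ₀ →
      φ s - s * deriv φ s + (ρ^2 - s^2) * deriv (deriv φ) s > 0)
    (hrA : rA = (e * g - f ^ 2) * b₀ - (b * g - c * f) * (e₀ / 2)
          - (c * e - b * f) * (f₀ - e₁ / 2))
    (hrB : rB = (e * g - f ^ 2) * (c₀ + b₁) - (b * g - c * f) * e₁ - (c * e - b * f) * g₀)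
    (hrC : rC = (e * g - f ^ 2) * c₁ - (b * g - c * f) * (f₁ - g₀ / 2)
          - (c * e - b * f) * (g₁ / 2))
    (H : ∀ y₀ y₁ q l : ℝ, q = e * y₀ ^ 2 + 2 * f * (y₀ * y₁) + g * y₁ ^ 2 → l = b * y₀ + c * y₁ →
      0 < q →
      vertDeriv φ q l (e * y₀ + f * y₁) b (e₁ * y₀ ^ 2 + 2 * f₁ * (y₀ * y₁) + g₁ * y₁ ^ 2)
        (b₁ * y₀ + c₁ * y₁) (e₁ * y₀ + f₁ * y₁) b₁
      - vertDeriv φ q l (f * y₀ + g * y₁) c (e₀ * y₀ ^ 2 + 2 * f₀ * (y₀ * y₁) + g₀ * y₁ ^ 2)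
        (b₀ * y₀ + c₀ * y₁) (f₀ * y₀ + g₀ * y₁) c₀
      = (C₀ * y₀ ^ 3 + C₁ * y₀ ^ 2 * y₁ + C₂ * y₀ * y₁ ^ 2 + C₃ * y₁ ^ 3)
        * (2 * hessFactor φ e f g b c y₀ y₁ q l)) :
    b₁ = c₀ ∧
      2 * rA * ((b * g - c * f) * c) + rB * ((c * e - b * f) * c - (b * g - c * f) * b)
        - 2 * rC * ((c * e - b * f) * b) = 0 ∧
      (rA * (b * g - c * f) ^ 2 + rB * ((b * g - c * f) * (c * e - b * f))
          + rC * (c * e - b * f) ^ 2) * (1 + k₁ * B)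
        = (e * g - f ^ 2) * (rA * c ^ 2 - rB * (c * b) + rC * b ^ 2)
          * (1 + (k₁ + k₃) * B + k₂ * B ^ 2) := by
  set Δ := e * g - f ^ 2 with hΔdef
  set u := b * g - c * f with hu
  set v := c * e - b * f with hv
  have hr : √Δ ^ 2 = Δ := Real.sq_sqrt hΔ.le
  have hr0 : 0 < √Δ := Real.sqrt_pos.2 hΔ
  have hsB : √B ^ 2 = B := Real.sq_sqrt hBpos.le
  have hsB0 : 0 < √B := Real.sqrt_pos.2 hBpos
  have hsBρ : √B < ρ₀ := (Real.sqrt_lt' hρ₀).2 hBρ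
  have hDpos : ∀ s ∈ Set.Ioo (-ρ₀) ρ₀, 0 < 1 + (k₁ + k₃) * s ^ 2 + k₂ * s ^ 4 := fun s hs => by
    have := ode_coeff_pos hk' hρ₀ hODE hreg (sq_nonneg s)
      (by rw [← sq_abs]; exact pow_lt_pow_left₀ (abs_lt.2 hs) (abs_nonneg s) two_ne_zero)
    calc 0 < _ := this
      _ = _ := by ring
  have hIoo : ∀ s ∈ Set.Ioo 0 √B, s ∈ Set.Ioo (-ρ₀) ρ₀ := fun s hs =>
    ⟨by linarith [hs.1], by linarith [hs.2]⟩
  obtain ⟨m₀, m₁, m₂, m₃, hm⟩ := exists_cubic_comp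
    (2 * Δ * C₀ - (e * (e₁ - f₀) - (e * e₁ - f * e₀) / 2))
    (2 * Δ * C₁ - (e * (f₁ - g₀) + 2 * f * (e₁ - f₀)
      - (2 * e * f₁ + f * e₁ - 2 * f * f₀ - g * e₀) / 2))
    (2 * Δ * C₂ - (2 * f * (f₁ - g₀) + g * (e₁ - f₀)
      - (e * g₁ + 2 * f * f₁ - f * g₀ - 2 * g * f₀) / 2))
    (2 * Δ * C₃ - (g * (f₁ - g₀) - (f * g₁ - g * g₀) / 2))
    (u / Δ) (v / Δ) (√Δ * c / Δ) (-(√Δ * b / Δ))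
  have hframe := frame_conditions (m₀ := m₀) (m₁ := m₁) (m₂ := m₂) (m₃ := m₃)
    (l := -(B / √Δ)) (S := -((b₁ - c₀) * √B ^ 3))
    (R₀ := (rA * u ^ 2 + rB * (u * v) + rC * v ^ 2) / Δ ^ 2)
    (R₁ := √Δ * (2 * rA * (u * c) + rB * (v * c - u * b) - 2 * rC * (v * b)) / Δ ^ 2)
    (R₂ := (rA * c ^ 2 - rB * (c * b) + rC * b ^ 2) / Δ)
    (Q := fun s => deriv φ s / (φ s - s * deriv φ s)) hBpos
    (neg_ne_zero.2 (div_pos hBpos hr0).ne') hk hk'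
    (ode_coeff_pos hk' hρ₀ hODE hreg hBpos.le hBρ).ne' (fun s hs => (hDpos s (hIoo s hs)).ne')
    (fun s hs => hasDerivAt_Q (hasDerivAt_of_smooth hφs (hIoo s hs)).1
      (hasDerivAt_of_smooth hφs (hIoo s hs)).2 (sub_mul_deriv_pos hreg (hIoo s hs)).ne'
      (hDpos s (hIoo s hs)).ne' (hODE s (hIoo s hs)))
  obtain ⟨hS, hR₁, hR₀⟩ := hframe <| by
    intro p q hpq
    have hy0 : Δ * (p * (u / Δ) + q * (√Δ * c / Δ)) = p * u + q * (√Δ * c) := by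
      field_simp
    have hy1 : Δ * (p * (v / Δ) + q * (-(√Δ * b / Δ))) = p * v - q * (√Δ * b) := by
      field_simp
      ring
    have hRy : rA * (p * (u / Δ) + q * (√Δ * c / Δ)) ^ 2
        + rB * ((p * (u / Δ) + q * (√Δ * c / Δ)) * (p * (v / Δ) + q * (-(√Δ * b / Δ))))
        + rC * (p * (v / Δ) + q * (-(√Δ * b / Δ))) ^ 2
        = (rA * u ^ 2 + rB * (u * v) + rC * v ^ 2) / Δ ^ 2 * p ^ 2
          + √Δ * (2 * rA * (u * c) + rB * (v * c - u * b) - 2 * rC * (v * b)) / Δ ^ 2 * p * q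
          + (rA * c ^ 2 - rB * (c * b) + rC * b ^ 2) / Δ * q ^ 2 := by
      field_simp
      linear_combination q ^ 2 * (rA * c ^ 2 - rB * (c * b) + rC * b ^ 2) * hr
    have hmy := hm p q
    rw [← hRy, ← hmy]
    clear hRy hmy hm
    generalize p * (u / Δ) + q * (√Δ * c / Δ) = y₀ at *
    generalize p * (v / Δ) + q * (-(√Δ * b / Δ)) = y₁ at *
    have hA : e * y₀ ^ 2 + 2 * f * (y₀ * y₁) + g * y₁ ^ 2 = B := by
      have : Δ ^ 2 * (e * y₀ ^ 2 + 2 * f * (y₀ * y₁) + g * y₁ ^ 2) = Δ ^ 2 * B := by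
        calc _ = e * (Δ * y₀) ^ 2 + 2 * f * ((Δ * y₀) * (Δ * y₁)) + g * (Δ * y₁) ^ 2 := by ring
          _ = Δ * (g * b ^ 2 - 2 * f * b * c + e * c ^ 2) * (p ^ 2 + q ^ 2)
            + (g * b ^ 2 - 2 * f * b * c + e * c ^ 2) * (√Δ ^ 2 - Δ) * q ^ 2 := by
            rw [hy0, hy1, hu, hv, hΔdef]
            ring
          _ = _ := by rw [← hB, hpq, hr]; ring
      exact mul_left_cancel₀ (pow_ne_zero 2 hΔ.ne') this
    have hl : b * y₀ + c * y₁ = B * p := by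
      have : Δ * (b * y₀ + c * y₁) = Δ * (B * p) := by
        calc _ = b * (Δ * y₀) + c * (Δ * y₁) := by ring
          _ = (g * b ^ 2 - 2 * f * b * c + e * c ^ 2) * p := by rw [hy0, hy1, hu, hv]; ring
          _ = _ := by rw [← hB]; ring
      exact mul_left_cancel₀ hΔ.ne' this
    have hκ : b * (f * y₀ + g * y₁) - c * (e * y₀ + f * y₁) = -(√Δ * B * q) := by
      have : Δ * (b * (f * y₀ + g * y₁) - c * (e * y₀ + f * y₁)) = Δ * (-(√Δ * B * q)) := by
        calc _ = b * (f * (Δ * y₀) + g * (Δ * y₁)) - c * (e * (Δ * y₀) + f * (Δ * y₁)) := by ring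
          _ = -(√Δ * (g * b ^ 2 - 2 * f * b * c + e * c ^ 2) * q) := by
            rw [hy0, hy1, hu, hv]; ring
          _ = _ := by rw [← hB]; ring
      exact mul_left_cancel₀ hΔ.ne' this
    have hsp : B * p / √B = √B * p := by
      field_simp
      rw [hsB, mul_comm]
    have hp : |p| ≤ 1 := by
      rw [← sq_le_one_iff_abs_le_one]
      nlinarith [sq_nonneg q]
    have hsI : √B * p ∈ Set.Ioo (-ρ₀) ρ₀ := by
      rw [Set.mem_Ioo, ← abs_lt, abs_mul, abs_of_pos hsB0]
      exact (mul_le_of_le_one_right hsB0.le hp).trans_lt hsBρ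
    have hid := hamel_defect_identity (k₁ := k₁) (k₂ := k₂) (k₃ := k₃) (φ := φ) hBpos hΔ
      (l := B * p) (κ := -(√Δ * B * q)) (B := B)
      (by linear_combination q ^ 2 * B ^ 2 * hr + Δ * B ^ 2 * hpq)
      (by rw [hsp]; exact sub_mul_deriv_pos hreg hsI) (by rw [hsp]; exact hODE _ hsI)
      (vertDeriv_sub_vertDeriv hBpos hΔ hA.symm hl.symm rfl hκ.symm rfl rfl)
      ((H y₀ y₁ B (B * p) hA.symm hl.symm hBpos).trans
        (by rw [hessFactor_eq hBpos hB hA.symm hl.symm]))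
    rw [hsp] at hid
    rw [← hrA, ← hrB, ← hrC] at hid
    have hq2 : q ^ 2 = 1 - p ^ 2 := by linarith
    have hlB : -(B / √Δ) = -(√Δ * B) / Δ := by
      field_simp
      rw [hr]
    rw [hlB]
    have e1 : (√B * p) ^ 2 = B * p ^ 2 := by rw [mul_pow, hsB]
    have e2 : (√B * p) ^ 4 = B ^ 2 * p ^ 4 := by
      rw [show (√B * p) ^ 4 = ((√B * p) ^ 2) ^ 2 by ring, e1]
      ring
    rw [e1, e2] at hid ⊢
    have hM : (2 * Δ * C₀ - (e * (e₁ - f₀) - (e * e₁ - f * e₀) / 2)) * y₀ ^ 3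
        + (2 * Δ * C₁ - (e * (f₁ - g₀) + 2 * f * (e₁ - f₀)
          - (2 * e * f₁ + f * e₁ - 2 * f * f₀ - g * e₀) / 2)) * y₀ ^ 2 * y₁
        + (2 * Δ * C₂ - (2 * f * (f₁ - g₀) + g * (e₁ - f₀)
          - (e * g₁ + 2 * f * f₁ - f * g₀ - 2 * g * f₀) / 2)) * y₀ * y₁ ^ 2
        + (2 * Δ * C₃ - (g * (f₁ - g₀) - (f * g₁ - g * g₀) / 2)) * y₁ ^ 3
        = 2 * Δ * (C₀ * y₀ ^ 3 + C₁ * y₀ ^ 2 * y₁ + C₂ * y₀ * y₁ ^ 2 + C₃ * y₁ ^ 3)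
          - (B * (e₁ * y₀ + f₁ * y₁ - (f₀ * y₀ + g₀ * y₁))
            - ((e * y₀ + f * y₁) * (e₁ * y₀ ^ 2 + 2 * f₁ * (y₀ * y₁) + g₁ * y₁ ^ 2)
            - (f * y₀ + g * y₁) * (e₀ * y₀ ^ 2 + 2 * f₀ * (y₀ * y₁) + g₀ * y₁ ^ 2)) / 2) := by
      rw [← hA]
      ring
    rw [hM]
    generalize 2 * Δ * (C₀ * y₀ ^ 3 + C₁ * y₀ ^ 2 * y₁ + C₂ * y₀ * y₁ ^ 2 + C₃ * y₁ ^ 3)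
          - (B * (e₁ * y₀ + f₁ * y₁ - (f₀ * y₀ + g₀ * y₁))
            - ((e * y₀ + f * y₁) * (e₁ * y₀ ^ 2 + 2 * f₁ * (y₀ * y₁) + g₁ * y₁ ^ 2)
            - (f * y₀ + g * y₁) * (e₀ * y₀ ^ 2 + 2 * f₀ * (y₀ * y₁) + g₀ * y₁ ^ 2)) / 2) = M at hid ⊢
    linear_combination -hid - M * (1 + k₁ * B) * hq2
  refine ⟨?_, ?_, ?_⟩
  · have : b₁ - c₀ = 0 := by simpa [hsB0.ne'] using hS
    linarith
  · simpa [hr0.ne', hΔ.ne'] using hR₁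
  · field_simp at hR₀
    linear_combination hR₀

end Pointwise

section Plane

open Filter Topology

variable {φ : ℝ → ℝ} {ρ₀ : ℝ} {U : Set Pt} {e f g b c B : Pt → ℝ} {k₁ k₂ k₃ : ℝ}

lemma qform_pos {x y : Pt} (he : 0 < e x) (hΔ : 0 < e x * g x - f x ^ 2) (hy : y ≠ 0) :
    0 < qform e f g x y := by
  have h : e x * qform e f g x y
      = (e x * y 0 + f x * y 1) ^ 2 + (e x * g x - f x ^ 2) * y 1 ^ 2 := by
    unfold qform
    ring
  refine pos_of_mul_pos_right (a := e x) ?_ he.le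
  rw [h]
  by_cases h1 : y 1 = 0
  · have h0 : y 0 ≠ 0 := fun h0 => hy (by ext i; fin_cases i <;> simp [h0, h1])
    rw [h1]
    simp only [mul_zero, add_zero]
    positivity
  · positivity

/-- The quadratic form `Δ r₀₀`, where `r` is the symmetrized covariant derivative of `β`. -/
def symCov (e f g b c : Pt → ℝ) (x : Pt) (y₀ y₁ z₀ z₁ : ℝ) : ℝ :=
  ((e x * g x - f x ^ 2) * pd b 0 x - (b x * g x - c x * f x) * (pd e 0 x / 2)
      - (c x * e x - b x * f x) * (pd f 0 x - pd e 1 x / 2)) * (y₀ * z₀)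
    + ((e x * g x - f x ^ 2) * (pd c 0 x + pd b 1 x) - (b x * g x - c x * f x) * pd e 1 x
      - (c x * e x - b x * f x) * pd g 0 x) * ((y₀ * z₁ + y₁ * z₀) / 2)
    + ((e x * g x - f x ^ 2) * pd c 1 x - (b x * g x - c x * f x) * (pd f 1 x - pd g 0 x / 2)
      - (c x * e x - b x * f x) * (pd g 1 x / 2)) * (y₁ * z₁)

lemma douglas_conditions (hU : IsOpen U)
    (hde : ∀ x ∈ U, DifferentiableAt ℝ e x) (hdf : ∀ x ∈ U, DifferentiableAt ℝ f x)
    (hdg : ∀ x ∈ U, DifferentiableAt ℝ g x) (hdb : ∀ x ∈ U, DifferentiableAt ℝ b x)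
    (hdc : ∀ x ∈ U, DifferentiableAt ℝ c x)
    (he : ∀ x ∈ U, 0 < e x) (hΔ : ∀ x ∈ U, 0 < e x * g x - f x ^ 2) (hBpos : ∀ x ∈ U, 0 < B x)
    (hB : ∀ x ∈ U, (e x * g x - f x ^ 2) * B x
      = g x * b x ^ 2 - 2 * f x * b x * c x + e x * c x ^ 2) (hρ₀ : 0 < ρ₀)
    (hBρ : ∀ x ∈ U, B x < ρ₀ ^ 2)
    (hk : k₂ ≠ (2 * k₁ + 3 * k₃) * (3 * k₁ + 2 * k₃) / 25) (hk' : k₂ ≠ k₁ * k₃)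
    (hφs : ContDiffOn ℝ (⊤ : ℕ∞) φ (Set.Ioo (-ρ₀) ρ₀))
    (hφpos : ∀ s ∈ Set.Ioo (-ρ₀) ρ₀, 0 < φ s)
    (hODE : ∀ s ∈ Set.Ioo (-ρ₀) ρ₀,
      (1 + (k₁ + k₃)*s^2 + k₂*s^4) * deriv (deriv φ) s
        = (k₁ + k₂*s^2) * (φ s - s * deriv φ s))
    (hreg : ∀ ρ s : ℝ, |s| ≤ ρ → ρ < ρ₀ →
      φ s - s * deriv φ s + (ρ^2 - s^2) * deriv (deriv φ) s > 0)
    (hD : IsDouglasOn (abMetric φ e f g b c) U) {x : Pt} (hx : x ∈ U) :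
    pd b 1 x = pd c 0 x ∧
      symCov e f g b c x (b x * g x - c x * f x) (c x * e x - b x * f x) (c x) (-b x) = 0 ∧
      symCov e f g b c x (b x * g x - c x * f x) (c x * e x - b x * f x)
          (b x * g x - c x * f x) (c x * e x - b x * f x) * (1 + k₁ * B x)
        = (e x * g x - f x ^ 2) * symCov e f g b c x (c x) (-b x) (c x) (-b x)
          * (1 + (k₁ + k₃) * B x + k₂ * B x ^ 2) := by
  have hsB : ∀ x ∈ U, √(B x) < ρ₀ := fun x hx => (Real.sqrt_lt' hρ₀).2 (hBρ x hx)
  have habs : ∀ x ∈ U, ∀ y, y ≠ 0 → |lform b c x y / √(qform e f g x y)| ≤ √(B x) :=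
    fun x hx y hy => Real.abs_le_sqrt
      (sq_lform_le (qform_pos (he x hx) (hΔ x hx) hy) (hΔ x hx) (hB x hx) rfl rfl)
  obtain ⟨C₀, C₁, C₂, C₃, hC⟩ := hD x hx
  obtain ⟨h1, h2, h3⟩ := douglas_pointwise (φ := φ) (e₀ := pd e 0 x) (e₁ := pd e 1 x)
    (f₀ := pd f 0 x) (f₁ := pd f 1 x) (g₀ := pd g 0 x) (g₁ := pd g 1 x) (b₀ := pd b 0 x)
    (b₁ := pd b 1 x) (c₀ := pd c 0 x) (c₁ := pd c 1 x) (C₀ := C₀) (C₁ := C₁) (C₂ := C₂) (C₃ := C₃)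
    (hΔ x hx) (hBpos x hx) (hB x hx) hρ₀ (hBρ x hx) hk hk' hφs hODE hreg rfl rfl rfl <| by
      intro y₀ y₁ q l hq' hl hq
      have hy : (![y₀, y₁] : Pt) ≠ 0 := by
        intro h
        have h0 : y₀ = 0 := congrFun h 0
        have h1 : y₁ = 0 := congrFun h 1
        simp [hq', h0, h1] at hq
      have hs := habs x hx _ hy
      have hqq : qform e f g x ![y₀, y₁] = q := hq'.symm
      have hll : lform b c x ![y₀, y₁] = l := hl.symm
      have hpos := hreg _ _ hs (hsB x hx)
      rw [Real.sq_sqrt (hBpos x hx).le, hqq, hll] at hpos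
      have hh : hessFactor φ (e x) (f x) (g x) (b x) (c x) y₀ y₁ q l ≠ 0 := by
        rw [hessFactor_eq hq (hB x hx) hq' hl]
        exact (mul_pos (div_pos (hΔ x hx) (pow_pos (Real.sqrt_pos.2 hq) 3)) hpos).ne'
      have hw := spray_abMetric_wedge (U := U) (fun s hs => (hasDerivAt_of_smooth hφs hs).1)
        (fun s hs => (hasDerivAt_of_smooth hφs hs).2) hφpos hy (hU.mem_nhds hx) (hde x hx)
        (hdf x hx) (hdg x hx) (hdb x hx) (hdc x hx)
        (fun x hx y hy => qform_pos (he x hx) (hΔ x hx) hy)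
        (fun x hx y hy => abs_lt.1 ((habs x hx y hy).trans_lt (hsB x hx)))
        (by rw [hqq, hll]; exact hh)
      rw [hC _ hy, hqq, hll] at hw
      have hw' := (eq_div_iff (mul_ne_zero two_ne_zero hh)).1 hw
      unfold mixedDeriv at hw'
      rw [hqq, hll] at hw'
      exact hw'.symm
  refine ⟨h1, ?_, ?_⟩
  · unfold symCov
    linear_combination h2 / 2
  · unfold symCov
    linear_combination h3

end Plane

section Plane

open Filter Topology

variable {U : Set Pt} {e f g b c B : Pt → ℝ} {k₁ k₂ k₃ : ℝ} {x : Pt}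

lemma pd_mul {p q : Pt → ℝ} (hp : DifferentiableAt ℝ p x) (hq : DifferentiableAt ℝ q x)
    (k : Fin 2) : pd (fun x => p x * q x) k x = pd p k x * q x + p x * pd q k x := by
  unfold pd
  rw [fderiv_fun_mul hp hq]
  simp
  ring

lemma pd_sub {p q : Pt → ℝ} (hp : DifferentiableAt ℝ p x) (hq : DifferentiableAt ℝ q x)
    (k : Fin 2) : pd (fun x => p x - q x) k x = pd p k x - pd q k x := by
  unfold pd
  rw [fderiv_fun_sub hp hq]
  simp

lemma pd_comp {h : ℝ → ℝ} {h' : ℝ} {p : Pt → ℝ} (hh : HasDerivAt h h' (p x))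
    (hp : DifferentiableAt ℝ p x) (k : Fin 2) : pd (fun x => h (p x)) k x = h' * pd p k x := by
  unfold pd
  have h1 : HasFDerivAt (fun x => h (p x)) (h' • fderiv ℝ p x) x :=
    hh.comp_hasFDerivAt x hp.hasFDerivAt
  rw [h1.fderiv]
  simp

lemma pd_norm_sq (hU : U ∈ 𝓝 x) (hde : DifferentiableAt ℝ e x) (hdf : DifferentiableAt ℝ f x)
    (hdg : DifferentiableAt ℝ g x) (hdb : DifferentiableAt ℝ b x) (hdc : DifferentiableAt ℝ c x)
    (hdB : DifferentiableAt ℝ B x)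
    (hB : ∀ x ∈ U, (e x * g x - f x ^ 2) * B x
      = g x * b x ^ 2 - 2 * f x * b x * c x + e x * c x ^ 2) (k : Fin 2) :
    (pd e k x * g x + e x * pd g k x - 2 * f x * pd f k x) * B x
        + (e x * g x - f x ^ 2) * pd B k x
      = pd g k x * b x ^ 2 + 2 * g x * b x * pd b k x
        - 2 * (pd f k x * b x * c x + f x * pd b k x * c x + f x * b x * pd c k x)
        + pd e k x * c x ^ 2 + 2 * e x * c x * pd c k x := by
  have h1 := (((hde.hasFDerivAt.fun_mul hdg.hasFDerivAt).fun_sub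
    (hdf.hasFDerivAt.pow 2)).fun_mul hdB.hasFDerivAt)
  have h2 := ((hdg.hasFDerivAt.fun_mul (hdb.hasFDerivAt.pow 2)).fun_sub
    (((hdf.hasFDerivAt.const_mul 2).fun_mul hdb.hasFDerivAt).fun_mul hdc.hasFDerivAt)).fun_add
    (hde.hasFDerivAt.fun_mul (hdc.hasFDerivAt.pow 2))
  have h3 := h1.congr_of_eventuallyEq
    (f₁ := fun x => g x * b x ^ 2 - 2 * f x * b x * c x + e x * c x ^ 2)
    (by filter_upwards [hU] with x hx using (hB x hx).symm)
  have h4 := DFunLike.congr_fun (h3.unique h2) (Pi.single k 1)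
  simp at h4
  unfold pd
  linear_combination h4

section Algebra

variable {e f g b c B B₀ B₁ e₀ e₁ f₀ f₁ g₀ g₁ b₀ b₁ c₀ c₁ rA rB rC : ℝ}

lemma norm_sq_gradient
    (hB : (e * g - f ^ 2) * B = g * b ^ 2 - 2 * f * b * c + e * c ^ 2) (hcl : b₁ = c₀)
    (hB₀ : (e₀ * g + e * g₀ - 2 * f * f₀) * B + (e * g - f ^ 2) * B₀
      = g₀ * b ^ 2 + 2 * g * b * b₀ - 2 * (f₀ * b * c + f * b₀ * c + f * b * c₀)
        + e₀ * c ^ 2 + 2 * e * c * c₀)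
    (hB₁ : (e₁ * g + e * g₁ - 2 * f * f₁) * B + (e * g - f ^ 2) * B₁
      = g₁ * b ^ 2 + 2 * g * b * b₁ - 2 * (f₁ * b * c + f * b₁ * c + f * b * c₁)
        + e₁ * c ^ 2 + 2 * e * c * c₁)
    (hrA : rA = (e * g - f ^ 2) * b₀ - (b * g - c * f) * (e₀ / 2)
          - (c * e - b * f) * (f₀ - e₁ / 2))
    (hrB : rB = (e * g - f ^ 2) * (c₀ + b₁) - (b * g - c * f) * e₁ - (c * e - b * f) * g₀)
    (hrC : rC = (e * g - f ^ 2) * c₁ - (b * g - c * f) * (f₁ - g₀ / 2)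
          - (c * e - b * f) * (g₁ / 2)) :
    (e * g - f ^ 2) ^ 2 * (B₀ * c - B₁ * b) = 2 * (rA * ((b * g - c * f) * c)
        + rB * (((b * g - c * f) * -b + (c * e - b * f) * c) / 2) + rC * ((c * e - b * f) * -b)) ∧
      (e * g - f ^ 2) ^ 2 * (B₀ * (b * g - c * f) + B₁ * (c * e - b * f))
      = 2 * (rA * ((b * g - c * f) * (b * g - c * f))
        + rB * (((b * g - c * f) * (c * e - b * f) + (c * e - b * f) * (b * g - c * f)) / 2)
        + rC * ((c * e - b * f) * (c * e - b * f))) := by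
  have h₀ : (e * g - f ^ 2) ^ 2 * B₀ = (e * g - f ^ 2) * (g₀ * b ^ 2 + 2 * g * b * b₀
      - 2 * (f₀ * b * c + f * b₀ * c + f * b * c₀) + e₀ * c ^ 2 + 2 * e * c * c₀)
      - (e₀ * g + e * g₀ - 2 * f * f₀) * (g * b ^ 2 - 2 * f * b * c + e * c ^ 2) := by
    linear_combination (e * g - f ^ 2) * hB₀ - (e₀ * g + e * g₀ - 2 * f * f₀) * hB
  have h₁ : (e * g - f ^ 2) ^ 2 * B₁ = (e * g - f ^ 2) * (g₁ * b ^ 2 + 2 * g * b * b₁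
      - 2 * (f₁ * b * c + f * b₁ * c + f * b * c₁) + e₁ * c ^ 2 + 2 * e * c * c₁)
      - (e₁ * g + e * g₁ - 2 * f * f₁) * (g * b ^ 2 - 2 * f * b * c + e * c ^ 2) := by
    linear_combination (e * g - f ^ 2) * hB₁ - (e₁ * g + e * g₁ - 2 * f * f₁) * hB
  subst hrA hrB hrC hcl
  constructor
  · linear_combination c * h₀ - b * h₁
  · linear_combination (b * g - c * f) * h₀ + (c * e - b * f) * h₁

lemma divergence_identity (hcl : b₁ = c₀)
    (hB : (e * g - f ^ 2) * B = g * b ^ 2 - 2 * f * b * c + e * c ^ 2)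
    (hrA : rA = (e * g - f ^ 2) * b₀ - (b * g - c * f) * (e₀ / 2)
          - (c * e - b * f) * (f₀ - e₁ / 2))
    (hrB : rB = (e * g - f ^ 2) * (c₀ + b₁) - (b * g - c * f) * e₁ - (c * e - b * f) * g₀)
    (hrC : rC = (e * g - f ^ 2) * c₁ - (b * g - c * f) * (f₁ - g₀ / 2)
          - (c * e - b * f) * (g₁ / 2)) :
    (e * g - f ^ 2) * B * (2 * (e * g - f ^ 2) * ((b₀ * g + b * g₀ - (c₀ * f + c * f₀))
          + (c₁ * e + c * e₁ - (b₁ * f + b * f₁)))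
        - ((b * g - c * f) * (e₀ * g + e * g₀ - 2 * f * f₀)
          + (c * e - b * f) * (e₁ * g + e * g₁ - 2 * f * f₁)))
      = 2 * ((rA * ((b * g - c * f) * (b * g - c * f))
        + rB * (((b * g - c * f) * (c * e - b * f) + (c * e - b * f) * (b * g - c * f)) / 2)
        + rC * ((c * e - b * f) * (c * e - b * f)))
        + (e * g - f ^ 2) * (rA * (c * c) + rB * ((c * -b + -b * c) / 2) + rC * (-b * -b))) := by
  rw [hB, hrA, hrB, hrC, hcl]
  ring

end Algebra

/-- The norm of `β` is constant along the kernel of `β`, and both the rescaled form `h(b²) β` and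
its Hodge dual are closed. -/
lemma closed_forms (hU : U ∈ 𝓝 x) (hde : DifferentiableAt ℝ e x) (hdf : DifferentiableAt ℝ f x)
    (hdg : DifferentiableAt ℝ g x) (hdb : DifferentiableAt ℝ b x) (hdc : DifferentiableAt ℝ c x)
    (hdB : DifferentiableAt ℝ B x) (hΔ : 0 < e x * g x - f x ^ 2) (hBpos : 0 < B x)
    (hB : ∀ x ∈ U, (e x * g x - f x ^ 2) * B x
      = g x * b x ^ 2 - 2 * f x * b x * c x + e x * c x ^ 2)
    (hcl : pd b 1 x = pd c 0 x)
    (hpolar : symCov e f g b c x (b x * g x - c x * f x) (c x * e x - b x * f x) (c x) (-b x) = 0)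
    (hratio : symCov e f g b c x (b x * g x - c x * f x) (c x * e x - b x * f x)
          (b x * g x - c x * f x) (c x * e x - b x * f x) * (1 + k₁ * B x)
        = (e x * g x - f x ^ 2) * symCov e f g b c x (c x) (-b x) (c x) (-b x)
          * (1 + (k₁ + k₃) * B x + k₂ * B x ^ 2))
    (hDB : 1 + (k₁ + k₃) * B x + k₂ * B x ^ 2 ≠ 0) {h : ℝ → ℝ} {h' : ℝ}
    (hh : HasDerivAt h h' (B x))
    (hh' : 2 * B x * (1 + (k₁ + k₃) * B x + k₂ * B x ^ 2) * h'
      = -(h (B x) * ((1 + k₁ * B x) + (1 + (k₁ + k₃) * B x + k₂ * B x ^ 2)))) :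
    pd B 0 x * c x = pd B 1 x * b x ∧
      pd (fun x => h (B x) * b x) 1 x = pd (fun x => h (B x) * c x) 0 x ∧
      pd (fun x => h (B x) * ((b x * f x - c x * e x) / √(e x * g x - f x ^ 2))) 1 x
        = pd (fun x => h (B x) * ((b x * g x - c x * f x) / √(e x * g x - f x ^ 2))) 0 x := by
  have hB₀ := pd_norm_sq hU hde hdf hdg hdb hdc hdB hB 0
  have hB₁ := pd_norm_sq hU hde hdf hdg hdb hdc hdB hB 1
  have hBx := hB x (mem_of_mem_nhds hU)
  obtain ⟨h1, h2⟩ := norm_sq_gradient hBx hcl hB₀ hB₁ rfl rfl rfl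
  have h3 := divergence_identity hcl hBx (e₀ := pd e 0 x) (e₁ := pd e 1 x) (f₀ := pd f 0 x)
    (f₁ := pd f 1 x) (g₀ := pd g 0 x) (g₁ := pd g 1 x) (b₀ := pd b 0 x) (c₁ := pd c 1 x) rfl rfl rfl
  change _ = 2 * symCov e f g b c x (b x * g x - c x * f x) (c x * e x - b x * f x) (c x) (-b x)
    at h1
  change _ = 2 * symCov e f g b c x (b x * g x - c x * f x) (c x * e x - b x * f x)
    (b x * g x - c x * f x) (c x * e x - b x * f x) at h2
  change _ = 2 * (symCov e f g b c x (b x * g x - c x * f x) (c x * e x - b x * f x)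
    (b x * g x - c x * f x) (c x * e x - b x * f x)
    + (e x * g x - f x ^ 2) * symCov e f g b c x (c x) (-b x) (c x) (-b x)) at h3
  have hgrad : pd B 0 x * c x = pd B 1 x * b x := by
    rw [hpolar, mul_zero] at h1
    exact sub_eq_zero.1 ((mul_eq_zero.1 h1).resolve_left (pow_ne_zero 2 hΔ.ne'))
  have hdh : DifferentiableAt ℝ (fun x => h (B x)) x :=
    (hh.comp_hasFDerivAt x hdB.hasFDerivAt).differentiableAt
  refine ⟨hgrad, ?_, ?_⟩
  · rw [pd_mul hdh hdb, pd_mul hdh hdc, pd_comp hh hdB, pd_comp hh hdB, hcl]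
    linear_combination -h' * hgrad
  · have hdΔ : DifferentiableAt ℝ (fun x => e x * g x - f x ^ 2) x :=
      (hde.fun_mul hdg).fun_sub (hdf.pow 2)
    have hpdΔ : ∀ k, pd (fun x => e x * g x - f x ^ 2) k x
        = pd e k x * g x + e x * pd g k x - 2 * f x * pd f k x := fun k => by
      unfold pd
      rw [((hde.hasFDerivAt.fun_mul hdg.hasFDerivAt).fun_sub (hdf.hasFDerivAt.pow 2)).fderiv]
      simp
      ring
    have hr := Real.sqrt_pos.2 hΔ
    have hr2 := Real.sq_sqrt hΔ.le
    have hinv : HasDerivAt (fun t => (√t)⁻¹) (-(1 / (2 * √(e x * g x - f x ^ 2)))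
        / √(e x * g x - f x ^ 2) ^ 2) (e x * g x - f x ^ 2) :=
      (Real.hasDerivAt_sqrt hΔ.ne').fun_inv hr.ne'
    have hdinv : DifferentiableAt ℝ (fun x => (√(e x * g x - f x ^ 2))⁻¹) x :=
      HasFDerivAt.differentiableAt (f := fun x => (√(e x * g x - f x ^ 2))⁻¹)
        (HasDerivAt.comp_hasFDerivAt (h₂ := fun t => (√t)⁻¹) x hinv hdΔ.hasFDerivAt)
    have hdn₀ := (hdb.fun_mul hdf).fun_sub (hdc.fun_mul hde)
    have hdn₁ := (hdb.fun_mul hdg).fun_sub (hdc.fun_mul hdf)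
    simp only [div_eq_mul_inv]
    rw [pd_mul hdh (hdn₀.fun_mul hdinv), pd_mul hdh (hdn₁.fun_mul hdinv), pd_mul hdn₀ hdinv,
      pd_mul hdn₁ hdinv, pd_sub (hdb.fun_mul hdf) (hdc.fun_mul hde),
      pd_sub (hdb.fun_mul hdg) (hdc.fun_mul hdf), pd_mul hdb hdf, pd_mul hdc hde, pd_mul hdb hdg,
      pd_mul hdc hdf, pd_comp hh hdB, pd_comp hh hdB, pd_comp hinv hdΔ, pd_comp hinv hdΔ, hpdΔ,
      hpdΔ]
    generalize symCov e f g b c x (b x * g x - c x * f x) (c x * e x - b x * f x)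
      (b x * g x - c x * f x) (c x * e x - b x * f x) = R₁ at *
    generalize symCov e f g b c x (c x) (-b x) (c x) (-b x) = R₂ at *
    generalize √(e x * g x - f x ^ 2) = r at *
    rw [← hr2] at h2 h3 hratio
    have hkey : 2 * r ^ 2 * h' * (pd B 0 x * (b x * g x - c x * f x)
          + pd B 1 x * (c x * e x - b x * f x))
        + h (B x) * (2 * r ^ 2 * ((pd b 0 x * g x + b x * pd g 0 x - (pd c 0 x * f x + c x * pd f 0 x))
          + (pd c 1 x * e x + c x * pd e 1 x - (pd b 1 x * f x + b x * pd f 1 x)))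
        - ((b x * g x - c x * f x) * (pd e 0 x * g x + e x * pd g 0 x - 2 * f x * pd f 0 x)
          + (c x * e x - b x * f x) * (pd e 1 x * g x + e x * pd g 1 x - 2 * f x * pd f 1 x)))
        = 0 := by
      have hne : B x * (1 + (k₁ + k₃) * B x + k₂ * B x ^ 2) * r ^ 2 ≠ 0 :=
        mul_ne_zero (mul_ne_zero hBpos.ne' hDB) (pow_ne_zero 2 hr.ne')
      refine (mul_eq_zero.1 ?_).resolve_left hne
      generalize pd B 0 x * (b x * g x - c x * f x) + pd B 1 x * (c x * e x - b x * f x) = X at *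
      generalize (2 * r ^ 2 * ((pd b 0 x * g x + b x * pd g 0 x - (pd c 0 x * f x + c x * pd f 0 x))
          + (pd c 1 x * e x + c x * pd e 1 x - (pd b 1 x * f x + b x * pd f 1 x)))
        - ((b x * g x - c x * f x) * (pd e 0 x * g x + e x * pd g 0 x - 2 * f x * pd f 0 x)
          + (c x * e x - b x * f x) * (pd e 1 x * g x + e x * pd g 1 x - 2 * f x * pd f 1 x)))
        = Y at *
      linear_combination r ^ 4 * X * hh'
        - h (B x) * ((1 + k₁ * B x) + (1 + (k₁ + k₃) * B x + k₂ * B x ^ 2)) * h2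
        + h (B x) * (1 + (k₁ + k₃) * B x + k₂ * B x ^ 2) * h3 - 2 * h (B x) * hratio
    field_simp
    linear_combination -hkey

end Plane

section Conformal

variable {k₁ k₂ k₃ R : ℝ}

/-- The factor `c` as a function of the squared norm of `β`. -/
def normFactor (k₁ k₂ k₃ t : ℝ) : ℝ :=
  Real.exp (∫ t in (0:ℝ)..t, (1/2) * ((k₃ + k₂*t) / (1 + (k₁ + k₃)*t + k₂*t^2)))

lemma normFactor_pos (t : ℝ) : 0 < normFactor k₁ k₂ k₃ t := Real.exp_pos _

lemma hasDerivAt_integral_ratio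
    (hD : ∀ t, 0 ≤ t → t < R → 0 < 1 + (k₁ + k₃) * t + k₂ * t ^ 2) {t : ℝ}
    (ht : t ∈ Set.Ioo 0 R) :
    HasDerivAt (fun t => ∫ t in (0:ℝ)..t, (1/2) * ((k₃ + k₂*t) / (1 + (k₁ + k₃)*t + k₂*t^2)))
      ((1/2) * ((k₃ + k₂*t) / (1 + (k₁ + k₃)*t + k₂*t^2))) t := by
  have hcont : ContinuousOn
      (fun t : ℝ => (1/2) * ((k₃ + k₂*t) / (1 + (k₁ + k₃)*t + k₂*t^2))) (Set.Ico 0 R) :=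
    continuousOn_const.mul ((by fun_prop : Continuous fun t : ℝ => k₃ + k₂ * t).continuousOn.div
      (by fun_prop : Continuous fun t : ℝ => 1 + (k₁ + k₃)*t + k₂*t^2).continuousOn
      (fun t ht => (hD t ht.1 ht.2).ne'))
  refine intervalIntegral.integral_hasDerivAt_right ?_ ?_ ?_
  · refine (hcont.mono ?_).intervalIntegrable
    rw [Set.uIcc_of_le ht.1.le]
    exact fun s hs => ⟨hs.1, hs.2.trans_lt ht.2⟩
  · exact (hcont.mono Set.Ioo_subset_Ico_self).stronglyMeasurableAtFilter isOpen_Ioo t ht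
  · exact (hcont.mono Set.Ioo_subset_Ico_self).continuousAt (isOpen_Ioo.mem_nhds ht)

lemma contDiffOn_normFactor
    (hD : ∀ t, 0 ≤ t → t < R → 0 < 1 + (k₁ + k₃) * t + k₂ * t ^ 2) :
    ContDiffOn ℝ (⊤ : ℕ∞) (normFactor k₁ k₂ k₃) (Set.Ioo 0 R) := by
  refine ContDiffOn.exp ((contDiffOn_infty_iff_deriv_of_isOpen isOpen_Ioo).2 ⟨fun t ht =>
    (hasDerivAt_integral_ratio hD ht).differentiableAt.differentiableWithinAt, ?_⟩)
  refine ContDiffOn.congr (f := fun t : ℝ => (1/2) * ((k₃ + k₂*t) / (1 + (k₁ + k₃)*t + k₂*t^2)))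
    ?_ fun t ht => (hasDerivAt_integral_ratio hD ht).deriv
  exact contDiffOn_const.mul ((by fun_prop : ContDiff ℝ _ fun t : ℝ => k₃ + k₂ * t).contDiffOn.div
      (by fun_prop : ContDiff ℝ _ fun t : ℝ => 1 + (k₁ + k₃)*t + k₂*t^2).contDiffOn
      (fun t ht => (hD t ht.1.le ht.2).ne'))

lemma hasDerivAt_normFactor_div
    (hD : ∀ t, 0 ≤ t → t < R → 0 < 1 + (k₁ + k₃) * t + k₂ * t ^ 2) {t : ℝ}
    (ht : t ∈ Set.Ioo 0 R) : ∃ h' : ℝ, HasDerivAt (fun t => normFactor k₁ k₂ k₃ t / t) h' t ∧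
      2 * t * (1 + (k₁ + k₃) * t + k₂ * t ^ 2) * h' = -(normFactor k₁ k₂ k₃ t / t
        * ((1 + k₁ * t) + (1 + (k₁ + k₃) * t + k₂ * t ^ 2))) := by
  refine ⟨_, ((hasDerivAt_integral_ratio hD ht).exp).fun_div (hasDerivAt_id t) ht.1.ne', ?_⟩
  have h0 := ht.1.ne'
  have h1 := (hD t ht.1.le ht.2).ne'
  simp only [normFactor]
  generalize hDt : 1 + (k₁ + k₃) * t + k₂ * t ^ 2 = D at h1 ⊢
  generalize rexp _ = E
  field_simp
  rw [← hDt]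
  ring

end Conformal

section Potential

open ContinuousLinearMap

/-- A closed smooth 1-form on a convex open subset of the plane has a smooth potential. -/
lemma exists_potential {s : Set Pt} (hs : Convex ℝ s) (hso : IsOpen s) {P Q : Pt → ℝ}
    (hP : ContDiffOn ℝ (⊤ : ℕ∞) P s) (hQ : ContDiffOn ℝ (⊤ : ℕ∞) Q s)
    (h : ∀ x ∈ s, pd P 1 x = pd Q 0 x) :
    ∃ X : Pt → ℝ, ContDiffOn ℝ (⊤ : ℕ∞) X s ∧
      ∀ x ∈ s, ∀ v : Pt, fderiv ℝ X x v = P x * v 0 + Q x * v 1 := by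
  set ω : Pt → Pt →L[ℝ] ℝ := fun x => P x • proj (R := ℝ) (φ := fun _ : Fin 2 => ℝ) 0
    + Q x • proj (R := ℝ) (φ := fun _ : Fin 2 => ℝ) 1 with hω
  have hωs : ContDiffOn ℝ (⊤ : ℕ∞) ω s :=
    (hP.smul contDiffOn_const).add (hQ.smul contDiffOn_const)
  have hd : DifferentiableOn ℝ ω s := hωs.differentiableOn (by simp)
  obtain ⟨X, hX⟩ := hs.exists_forall_hasFDerivAt_of_fderiv_symmetric hso hd (by
    intro x hx v w
    have hPx := ((hP.differentiableOn (by simp)) x hx).differentiableAt (hso.mem_nhds hx)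
    have hQx := ((hQ.differentiableOn (by simp)) x hx).differentiableAt (hso.mem_nhds hx)
    have hfd := ((hPx.hasFDerivAt.smul_const (proj (R := ℝ) (φ := fun _ : Fin 2 => ℝ) 0)).fun_add
      (hQx.hasFDerivAt.smul_const (proj (R := ℝ) (φ := fun _ : Fin 2 => ℝ) 1))).fderiv
    have hlin : ∀ (L : Pt →L[ℝ] ℝ) (v : Pt), L v = L (Pi.single 0 1) * v 0 + L (Pi.single 1 1) * v 1 := by
      intro L v
      have hv : v = v 0 • (Pi.single 0 1 : Pt) + v 1 • (Pi.single 1 1 : Pt) := by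
        ext i; fin_cases i <;> simp
      conv_lhs => rw [hv]
      rw [map_add, map_smul, map_smul, smul_eq_mul, smul_eq_mul]
      ring
    have hx' := h x hx
    rw [hω, hfd]
    simp
    rw [hlin (fderiv ℝ P x) v, hlin (fderiv ℝ Q x) v, hlin (fderiv ℝ P x) w,
      hlin (fderiv ℝ Q x) w]
    simp only [pd] at hx'
    rw [hx']
    ring)
  refine ⟨X, (contDiffOn_infty_iff_fderiv_of_isOpen hso).2 ⟨fun x hx =>
    (hX x hx).differentiableAt.differentiableWithinAt, hωs.congr fun x hx => (hX x hx).fderiv⟩, ?_⟩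
  intro x hx v
  rw [(hX x hx).fderiv, hω]
  simp

end Potential

section Chart

/-- A smooth map of the plane with independent differentials of its components is locally the
inverse of a coordinate chart. -/
lemma exists_chart {s : Set Pt} (hso : IsOpen s) {X : Pt → Pt}
    (hX : ContDiffOn ℝ (⊤ : ℕ∞) X s)
    (hdet : ∀ x ∈ s, LinearMap.det ((fderiv ℝ X x) : Pt →ₗ[ℝ] Pt) ≠ 0) {x₀ : Pt} (hx₀ : x₀ ∈ s) :
    ∃ (V : Set Pt) (ψ : Pt → Pt), IsCoordChart ψ V s ∧ x₀ ∈ ψ '' V ∧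
      ∀ z ∈ V, ∀ y, fderiv ℝ X (ψ z) (fderiv ℝ ψ z y) = y := by
  have hXx : ∀ x ∈ s, ContDiffAt ℝ (⊤ : ℕ∞) X x := fun x hx => hX.contDiffAt (hso.mem_nhds hx)
  set E : ∀ x ∈ s, Pt ≃L[ℝ] Pt := fun x hx =>
    (fderiv ℝ X x).toContinuousLinearEquivOfDetNeZero (hdet x hx)
  have hE : ∀ x (hx : x ∈ s), HasFDerivAt X (E x hx : Pt →L[ℝ] Pt) x := fun x hx => by
    rw [ContinuousLinearMap.coe_toContinuousLinearEquivOfDetNeZero]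
    exact ((hXx x hx).differentiableAt (by simp)).hasFDerivAt
  set T := (hXx x₀ hx₀).toOpenPartialHomeomorph X (hE x₀ hx₀) (by simp) with hT
  have hTX : ∀ x, T x = X x := fun x => rfl
  set V := T.target ∩ T.symm ⁻¹' s with hV
  have hVo : IsOpen V := T.symm.isOpen_inter_preimage hso
  have hsmooth : ∀ z ∈ V, ContDiffAt ℝ (⊤ : ℕ∞) T.symm z := fun z hz =>
    T.contDiffAt_symm hz.1 (hE _ hz.2) (hXx _ hz.2)
  have hinv : ∀ z ∈ V, ∀ y, fderiv ℝ X (T.symm z) (fderiv ℝ T.symm z y) = y := by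
    intro z hz y
    have h1 : HasFDerivAt (fun z => X (T.symm z))
        ((fderiv ℝ X (T.symm z)).comp (fderiv ℝ T.symm z)) z :=
      (((hXx _ hz.2).differentiableAt (by simp)).hasFDerivAt).comp z
        ((hsmooth z hz).differentiableAt (by simp)).hasFDerivAt
    have h2 : HasFDerivAt (fun z => X (T.symm z)) (ContinuousLinearMap.id ℝ Pt) z := by
      refine (hasFDerivAt_id z).congr_of_eventuallyEq ?_
      filter_upwards [hVo.mem_nhds hz] with w hw using T.right_inv hw.1
    exact DFunLike.congr_fun (h1.unique h2) y
  have hx₀T : x₀ ∈ T.source := (hXx x₀ hx₀).mem_toOpenPartialHomeomorph_source (hE x₀ hx₀) (by simp)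
  refine ⟨V, T.symm, ⟨hVo, fun z hz => (hsmooth z hz).contDiffWithinAt,
    T.symm.injOn.mono Set.inter_subset_left, ?_, ?_⟩, ?_, hinv⟩
  · rintro _ ⟨z, hz, rfl⟩
    exact hz.2
  · intro z hz h0
    have hcomp : ((fderiv ℝ X (T.symm z)) : Pt →ₗ[ℝ] Pt) ∘ₗ ((fderiv ℝ T.symm z) : Pt →ₗ[ℝ] Pt)
        = LinearMap.id := LinearMap.ext (hinv z hz)
    have := congrArg LinearMap.det hcomp
    rw [LinearMap.det_comp, h0, mul_zero, LinearMap.det_id] at this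
    exact zero_ne_one this
  · exact ⟨T x₀, ⟨T.map_source hx₀T, by rw [Set.mem_preimage, T.left_inv hx₀T]; exact hx₀⟩,
      T.left_inv hx₀T⟩

end Chart

section NormalForm

variable {e f g b c B : Pt → ℝ} {x : Pt}

/-- The form `lform` and its Hodge dual diagonalize the quadratic form `qform`. -/
lemma sq_lform_add_sq_dual (hΔ : 0 < e x * g x - f x ^ 2)
    (hB : (e x * g x - f x ^ 2) * B x = g x * b x ^ 2 - 2 * f x * b x * c x + e x * c x ^ 2)
    (y : Pt) :
    lform b c x y ^ 2 + ((b x * f x - c x * e x) / √(e x * g x - f x ^ 2) * y 0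
      + (b x * g x - c x * f x) / √(e x * g x - f x ^ 2) * y 1) ^ 2 = B x * qform e f g x y := by
  have hs := Real.sq_sqrt hΔ.le
  have hs0 : √(e x * g x - f x ^ 2) ≠ 0 := (Real.sqrt_pos.2 hΔ).ne'
  generalize √(e x * g x - f x ^ 2) = r at hs hs0
  unfold qform lform
  field_simp
  rw [hs]
  linear_combination (-(e x * y 0 ^ 2 + 2 * f x * (y 0 * y 1) + g x * y 1 ^ 2)) * hB

/-- Isothermal coordinates adapted to a pair of closed forms proportional to `β` and its dual. -/
lemma exists_adapted_chart {s : Set Pt} (hs : Convex ℝ s) (hso : IsOpen s) {η : Pt → ℝ}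
    (he : ∀ x ∈ s, ContDiffAt ℝ (⊤ : ℕ∞) e x) (hf : ∀ x ∈ s, ContDiffAt ℝ (⊤ : ℕ∞) f x)
    (hg : ∀ x ∈ s, ContDiffAt ℝ (⊤ : ℕ∞) g x) (hb : ∀ x ∈ s, ContDiffAt ℝ (⊤ : ℕ∞) b x)
    (hc : ∀ x ∈ s, ContDiffAt ℝ (⊤ : ℕ∞) c x) (hη : ∀ x ∈ s, ContDiffAt ℝ (⊤ : ℕ∞) η x)
    (hηpos : ∀ x ∈ s, 0 < η x) (he₀ : ∀ x ∈ s, 0 < e x)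
    (hΔ : ∀ x ∈ s, 0 < e x * g x - f x ^ 2) (hBpos : ∀ x ∈ s, 0 < B x)
    (hB : ∀ x ∈ s, (e x * g x - f x ^ 2) * B x
      = g x * b x ^ 2 - 2 * f x * b x * c x + e x * c x ^ 2)
    (hcl : ∀ x ∈ s, pd (fun x => η x * b x) 1 x = pd (fun x => η x * c x) 0 x)
    (hcl' : ∀ x ∈ s, pd (fun x => η x * ((b x * f x - c x * e x) / √(e x * g x - f x ^ 2))) 1 x
      = pd (fun x => η x * ((b x * g x - c x * f x) / √(e x * g x - f x ^ 2))) 0 x)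
    {x₀ : Pt} (hx₀ : x₀ ∈ s) :
    ∃ (V : Set Pt) (ψ : Pt → Pt), IsCoordChart ψ V s ∧ x₀ ∈ ψ '' V ∧ ∀ z ∈ V, ∀ y : Pt,
      η (ψ z) * lform b c (ψ z) (fderiv ℝ ψ z y) = y 0 ∧
      η (ψ z) ^ 2 * (B (ψ z) * qform e f g (ψ z) (fderiv ℝ ψ z y)) = y 0 ^ 2 + y 1 ^ 2 := by
  have hr : ∀ x ∈ s, ContDiffAt ℝ (⊤ : ℕ∞) (fun x => √(e x * g x - f x ^ 2)) x := fun x hx =>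
    (((he x hx).mul (hg x hx)).sub ((hf x hx).pow 2)).sqrt (hΔ x hx).ne'
  have hr0 : ∀ x ∈ s, √(e x * g x - f x ^ 2) ≠ 0 := fun x hx => (Real.sqrt_pos.2 (hΔ x hx)).ne'
  obtain ⟨X₀, hX₀, hX₀'⟩ := exists_potential hs hso (P := fun x => η x * b x)
    (Q := fun x => η x * c x) (fun x hx => ((hη x hx).mul (hb x hx)).contDiffWithinAt)
    (fun x hx => ((hη x hx).mul (hc x hx)).contDiffWithinAt) hcl
  obtain ⟨X₁, hX₁, hX₁'⟩ := exists_potential hs hso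
    (P := fun x => η x * ((b x * f x - c x * e x) / √(e x * g x - f x ^ 2)))
    (Q := fun x => η x * ((b x * g x - c x * f x) / √(e x * g x - f x ^ 2)))
    (fun x hx => ((hη x hx).mul ((((hb x hx).mul (hf x hx)).sub ((hc x hx).mul (he x hx))).div
      (hr x hx) (hr0 x hx))).contDiffWithinAt)
    (fun x hx => ((hη x hx).mul ((((hb x hx).mul (hg x hx)).sub ((hc x hx).mul (hf x hx))).div
      (hr x hx) (hr0 x hx))).contDiffWithinAt) hcl'
  have hX : ContDiffOn ℝ (⊤ : ℕ∞) (fun x => (![X₀ x, X₁ x] : Pt)) s := by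
    rw [contDiffOn_pi]
    intro i
    fin_cases i
    exacts [hX₀, hX₁]
  have hfd : ∀ x ∈ s, ∀ w : Pt, fderiv ℝ (fun x => (![X₀ x, X₁ x] : Pt)) x w
      = ![fderiv ℝ X₀ x w, fderiv ℝ X₁ x w] := by
    intro x hx w
    have hd : ∀ i, DifferentiableAt ℝ (fun x => (![X₀ x, X₁ x] : Pt) i) x := by
      intro i
      fin_cases i
      exacts [(hX₀.contDiffAt (hso.mem_nhds hx)).differentiableAt (by simp),
        (hX₁.contDiffAt (hso.mem_nhds hx)).differentiableAt (by simp)]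
    rw [fderiv_pi hd]
    ext i
    fin_cases i <;> rfl
  have hnorm : ∀ x ∈ s, ∀ w : Pt, η x ^ 2 * (B x * qform e f g x w)
      = fderiv ℝ X₀ x w ^ 2 + fderiv ℝ X₁ x w ^ 2 := by
    intro x hx w
    rw [← sq_lform_add_sq_dual (hΔ x hx) (hB x hx), hX₀' x hx, hX₁' x hx, lform]
    ring
  obtain ⟨V, ψ, hψ, hxV, hinv⟩ := exists_chart hso hX (by
    intro x hx hdet
    obtain ⟨w, hw, hw0⟩ := (Submodule.ne_bot_iff _).1
      (LinearMap.bot_lt_ker_of_det_eq_zero hdet).ne'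
    have hw' : fderiv ℝ (fun x => (![X₀ x, X₁ x] : Pt)) x w = 0 := hw
    rw [hfd x hx] at hw'
    have h0 : fderiv ℝ X₀ x w = 0 := congrFun hw' 0
    have h1 : fderiv ℝ X₁ x w = 0 := congrFun hw' 1
    have h := hnorm x hx w
    have hq := qform_pos (he₀ x hx) (hΔ x hx) hw0
    have hη' := hηpos x hx
    have hB' := hBpos x hx
    rw [h0, h1] at h
    have : 0 < η x ^ 2 * (B x * qform e f g x w) := by positivity
    linarith) hx₀
  refine ⟨V, ψ, hψ, hxV, fun z hz y => ?_⟩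
  have hzs : ψ z ∈ s := hψ.2.2.2.1 ⟨z, hz, rfl⟩
  have h := hinv z hz y
  rw [hfd _ hzs] at h
  have h0 : fderiv ℝ X₀ (ψ z) (fderiv ℝ ψ z y) = y 0 := congrFun h 0
  have h1 : fderiv ℝ X₁ (ψ z) (fderiv ℝ ψ z y) = y 1 := congrFun h 1
  refine ⟨?_, by rw [hnorm _ hzs, h0, h1]⟩
  rw [← h0, hX₀' _ hzs, lform]
  ring

/-- A function whose gradient is proportional to `β` is constant along the kernel of `β`. -/
lemma fderiv_apply_eq_zero_of_lform_eq_zero (hbc : b x ≠ 0 ∨ c x ≠ 0)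
    (hgrad : pd B 0 x * c x = pd B 1 x * b x) {w : Pt} (hw : lform b c x w = 0) :
    fderiv ℝ B x w = 0 := by
  have hv : fderiv ℝ B x w = pd B 0 x * w 0 + pd B 1 x * w 1 := by
    have hw' : w = w 0 • (Pi.single 0 1 : Pt) + w 1 • (Pi.single 1 1 : Pt) := by
      ext i; fin_cases i <;> simp
    conv_lhs => rw [hw', map_add, map_smul, map_smul, smul_eq_mul, smul_eq_mul]
    unfold pd
    ring
  unfold lform at hw
  rw [hv]
  rcases hbc with h | h <;> refine (mul_eq_zero.1 (?_ : _ * (_ : ℝ) = 0)).resolve_right h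
  · linear_combination pd B 0 x * hw - w 1 * hgrad
  · linear_combination pd B 1 x * hw + w 0 * hgrad

end NormalForm

lemma alphaF_eq_sqrt_qform {a : Pt → Matrix (Fin 2) (Fin 2) ℝ} {x : Pt}
    (hsym : a x 1 0 = a x 0 1) (y : Pt) :
    alphaF a x y = √(qform (fun x => a x 0 0) (fun x => a x 0 1) (fun x => a x 1 1) x y) := by
  simp only [alphaF, qform, Fin.sum_univ_two, hsym]
  congr 1
  ring

lemma betaF_eq_lform (b : Pt → Fin 2 → ℝ) (x y : Pt) :
    betaF b x y = lform (fun x => b x 0) (fun x => b x 1) x y := by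
  simp only [betaF, lform, Fin.sum_univ_two]

lemma det_mul_bsq {a : Pt → Matrix (Fin 2) (Fin 2) ℝ} {b : Pt → Fin 2 → ℝ} {x : Pt}
    (hsym : a x 1 0 = a x 0 1) (hΔ : 0 < a x 0 0 * a x 1 1 - a x 0 1 ^ 2) :
    (a x 0 0 * a x 1 1 - a x 0 1 ^ 2) * bsq a b x
      = a x 1 1 * b x 0 ^ 2 - 2 * a x 0 1 * b x 0 * b x 1 + a x 0 0 * b x 1 ^ 2 := by
  have h : a x 0 0 * a x 1 1 - a x 0 1 * a x 0 1 ≠ 0 := by rw [← sq]; exact hΔ.ne'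
  simp only [bsq, bUp, Matrix.inv_def, Matrix.adjugate_fin_two, Matrix.det_fin_two,
    Fin.sum_univ_two, Ring.inverse_eq_inv', Matrix.smul_apply, Matrix.of_apply, smul_eq_mul,
    Matrix.cons_val_zero, Matrix.cons_val_one, Matrix.cons_val', hsym]
  field_simp
  ring

/-- Theorem 1.3 of the paper (local structure of two-dimensional regular
Douglas (α,β)-metrics with φ solving the basic ODE). -/
theorem stmt2 (k₁ k₂ k₃ : ℝ)
    (hk : k₂ ≠ (2*k₁ + 3*k₃) * (3*k₁ + 2*k₃) / 25) (hk' : k₂ ≠ k₁ * k₃)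
    (U : Set Pt) (hU : IsOpen U)
    (a : Pt → Matrix (Fin 2) (Fin 2) ℝ) (b : Pt → Fin 2 → ℝ)
    (ha : ∀ i j, ContDiffOn ℝ (⊤ : ℕ∞) (fun x => a x i j) U)
    (hsym : ∀ x ∈ U, ∀ i j, a x i j = a x j i)
    (hpos : ∀ x ∈ U, (a x).PosDef)
    (hb : ∀ i, ContDiffOn ℝ (⊤ : ℕ∞) (fun x => b x i) U)
    (hbne : ∀ x ∈ U, b x ≠ 0)
    (φ : ℝ → ℝ) (b₀ : ℝ) (hb₀ : 0 < b₀)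
    (hbb : ∀ x ∈ U, bsq a b x < b₀^2)
    (hφs : ContDiffOn ℝ (⊤ : ℕ∞) φ (Set.Ioo (-b₀) b₀))
    (hφpos : ∀ s ∈ Set.Ioo (-b₀) b₀, 0 < φ s)
    (hφ0 : φ 0 = 1)
    -- φ satisfies the ODE (1.2)
    (hODE : ∀ s ∈ Set.Ioo (-b₀) b₀,
      (1 + (k₁ + k₃)*s^2 + k₂*s^4) * deriv (deriv φ) s
        = (k₁ + k₂*s^2) * (φ s - s * deriv φ s))
    -- regularity
    (hreg : ∀ ρ s : ℝ, |s| ≤ ρ → ρ < b₀ →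
      φ s - s * deriv φ s + (ρ^2 - s^2) * deriv (deriv φ) s > 0)
    -- F is a Douglas metric
    (hD : IsDouglasOn (fun x y => alphaF a x y * φ (betaF b x y / alphaF a x y)) U) :
    ∀ x₀ ∈ U, ∃ (V : Set Pt) (ψ : Pt → Pt), IsCoordChart ψ V U ∧ x₀ ∈ ψ '' V ∧
      ∃ B u v σ : Pt → ℝ,
        ContDiffOn ℝ (⊤ : ℕ∞) B V ∧ ContDiffOn ℝ (⊤ : ℕ∞) u V ∧
        ContDiffOn ℝ (⊤ : ℕ∞) v V ∧ (∀ z ∈ V, 0 < B z) ∧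
        -- σ is defined by e^{2σ} = B/(c²(u²+v²))
        (∀ z ∈ V, Real.exp (2 * σ z) =
          B z / ((Real.exp (∫ t in (0:ℝ)..(B z),
              (1/2) * ((k₃ + k₂*t) / (1 + (k₁ + k₃)*t + k₂*t^2))))^2 * (u z^2 + v z^2))) ∧
        -- the PDEs (1.7):  u₁ = v₂,  u₂ = −v₁,  v₁ + σ₁ v = u σ₂
        (∀ z ∈ V, pd u 0 z = pd v 1 z ∧ pd u 1 z = - pd v 0 z ∧
          pd v 0 z + pd σ 0 z * v z = u z * pd σ 1 z) ∧
        -- the local form (1.6) of α and β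
        (∀ z ∈ V, ∀ y : Fin 2 → ℝ,
          alphaF a (ψ z) (fderiv ℝ ψ z y) =
            Real.sqrt (B z) / (Real.exp (∫ t in (0:ℝ)..(B z),
                (1/2) * ((k₃ + k₂*t) / (1 + (k₁ + k₃)*t + k₂*t^2))))
              * Real.sqrt (((y 0)^2 + (y 1)^2) / (u z^2 + v z^2)) ∧
          betaF b (ψ z) (fderiv ℝ ψ z y) =
            B z * (u z * y 0 + v z * y 1)
              / ((Real.exp (∫ t in (0:ℝ)..(B z),
                  (1/2) * ((k₃ + k₂*t) / (1 + (k₁ + k₃)*t + k₂*t^2)))) * (u z^2 + v z^2))) := by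
  set e : Pt → ℝ := fun x => a x 0 0 with he
  set f : Pt → ℝ := fun x => a x 0 1 with hf
  set g : Pt → ℝ := fun x => a x 1 1 with hg
  set p : Pt → ℝ := fun x => b x 0 with hp
  set q : Pt → ℝ := fun x => b x 1 with hq
  have hsym' : ∀ x ∈ U, a x 1 0 = a x 0 1 := fun x hx => hsym x hx 1 0
  have hes : ∀ x ∈ U, ContDiffAt ℝ (⊤ : ℕ∞) e x := fun x hx =>
    (ha 0 0).contDiffAt (hU.mem_nhds hx)
  have hfs : ∀ x ∈ U, ContDiffAt ℝ (⊤ : ℕ∞) f x := fun x hx =>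
    (ha 0 1).contDiffAt (hU.mem_nhds hx)
  have hgs : ∀ x ∈ U, ContDiffAt ℝ (⊤ : ℕ∞) g x := fun x hx =>
    (ha 1 1).contDiffAt (hU.mem_nhds hx)
  have hps : ∀ x ∈ U, ContDiffAt ℝ (⊤ : ℕ∞) p x := fun x hx =>
    (hb 0).contDiffAt (hU.mem_nhds hx)
  have hqs : ∀ x ∈ U, ContDiffAt ℝ (⊤ : ℕ∞) q x := fun x hx =>
    (hb 1).contDiffAt (hU.mem_nhds hx)
  have he₀ : ∀ x ∈ U, 0 < e x := fun x hx => (hpos x hx).diag_pos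
  have hΔ : ∀ x ∈ U, 0 < e x * g x - f x ^ 2 := by
    intro x hx
    have h := (hpos x hx).det_pos
    rw [Matrix.det_fin_two, hsym' x hx, ← sq] at h
    exact h
  have hpq : ∀ x ∈ U, p x ≠ 0 ∨ q x ≠ 0 := by
    intro x hx
    by_contra! h
    exact hbne x hx (by ext i; fin_cases i; exacts [h.1, h.2])
  set B : Pt → ℝ := bsq a b with hBdef
  have hB : ∀ x ∈ U, (e x * g x - f x ^ 2) * B x
      = g x * p x ^ 2 - 2 * f x * p x * q x + e x * q x ^ 2 := fun x hx =>
    det_mul_bsq (hsym' x hx) (hΔ x hx)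
  have hBpos : ∀ x ∈ U, 0 < B x := by
    intro x hx
    refine pos_of_mul_pos_right (a := e x * g x - f x ^ 2) ?_ (hΔ x hx).le
    have hy : (![q x, -p x] : Pt) ≠ 0 := by
      intro h
      rcases hpq x hx with h' | h'
      · exact h' (neg_eq_zero.1 (congrFun h 1))
      · exact h' (congrFun h 0)
    have h := qform_pos (f := f) (g := g) (he₀ x hx) (hΔ x hx) hy
    rw [hB x hx]
    simp only [qform, Matrix.cons_val_zero, Matrix.cons_val_one] at h
    linarith
  have hBs : ∀ x ∈ U, ContDiffAt ℝ (⊤ : ℕ∞) B x := by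
    intro x hx
    refine ContDiffAt.congr_of_eventuallyEq (f := fun x =>
      (g x * p x ^ 2 - 2 * f x * p x * q x + e x * q x ^ 2) / (e x * g x - f x ^ 2)) ?_ ?_
    · have := hes x hx
      have := hfs x hx
      have := hgs x hx
      have := hps x hx
      have := hqs x hx
      exact ContDiffAt.div (by fun_prop) (by fun_prop) (hΔ x hx).ne'
    · filter_upwards [hU.mem_nhds hx] with x' hx'
      exact eq_div_of_mul_eq (hΔ x' hx').ne' (by rw [mul_comm]; exact hB x' hx')
  have hD' : IsDouglasOn (abMetric φ e f g p q) U := by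
    intro x hx
    obtain ⟨C₀, C₁, C₂, C₃, hC⟩ := hD x hx
    refine ⟨C₀, C₁, C₂, C₃, fun y hy => ?_⟩
    rw [← hC y hy]
    have hev : ∀ᶠ x' in nhds x, abMetric φ e f g p q x'
        = fun y => alphaF a x' y * φ (betaF b x' y / alphaF a x' y) := by
      filter_upwards [hU.mem_nhds hx] with x' hx'
      ext y
      rw [alphaF_eq_sqrt_qform (hsym' x' hx'), betaF_eq_lform]
      rfl
    rw [spray_congr hev, spray_congr hev]
  have hdiff : ∀ {h : Pt → ℝ}, (∀ x ∈ U, ContDiffAt ℝ (⊤ : ℕ∞) h x) →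
      ∀ x ∈ U, DifferentiableAt ℝ h x := fun hh x hx => (hh x hx).differentiableAt (by simp)
  have hcoeff : ∀ t, 0 ≤ t → t < b₀ ^ 2 → 0 < 1 + (k₁ + k₃) * t + k₂ * t ^ 2 :=
    fun t ht ht' => ode_coeff_pos hk' hb₀ hODE hreg ht ht'
  have hBmem : ∀ x ∈ U, B x ∈ Set.Ioo 0 (b₀ ^ 2) := fun x hx => ⟨hBpos x hx, hbb x hx⟩
  set N := normFactor k₁ k₂ k₃ with hN
  have hNs : ∀ x ∈ U, ContDiffAt ℝ (⊤ : ℕ∞) N (B x) := fun x hx =>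
    (contDiffOn_normFactor hcoeff).contDiffAt (isOpen_Ioo.mem_nhds (hBmem x hx))
  have hforms : ∀ x ∈ U, pd B 0 x * q x = pd B 1 x * p x ∧
      pd (fun x => N (B x) / B x * p x) 1 x = pd (fun x => N (B x) / B x * q x) 0 x ∧
      pd (fun x => N (B x) / B x * ((p x * f x - q x * e x) / √(e x * g x - f x ^ 2))) 1 x
        = pd (fun x => N (B x) / B x * ((p x * g x - q x * f x) / √(e x * g x - f x ^ 2))) 0 x := by
    intro x hx
    obtain ⟨h1, h2, h3⟩ := douglas_conditions hU (hdiff hes) (hdiff hfs) (hdiff hgs) (hdiff hps)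
      (hdiff hqs) he₀ hΔ hBpos hB hb₀ hbb hk hk' hφs hφpos hODE hreg hD' hx
    obtain ⟨h', hh, hh'⟩ := hasDerivAt_normFactor_div hcoeff (hBmem x hx)
    exact closed_forms (h := fun t => N t / t) (hU.mem_nhds hx) (hdiff hes x hx) (hdiff hfs x hx)
      (hdiff hgs x hx) (hdiff hps x hx) (hdiff hqs x hx) (hdiff hBs x hx) (hΔ x hx) (hBpos x hx) hB
      h1 h2 h3 (hcoeff _ (hBpos x hx).le (hbb x hx)).ne' hh hh'
  intro x₀ hx₀
  obtain ⟨r, hr, hrU⟩ := Metric.isOpen_iff.1 hU x₀ hx₀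
  obtain ⟨V, ψ, hψ, hxV, hform⟩ := exists_adapted_chart (B := B) (η := fun x => N (B x) / B x)
    (convex_ball x₀ r) Metric.isOpen_ball (fun x hx => hes x (hrU hx)) (fun x hx => hfs x (hrU hx))
    (fun x hx => hgs x (hrU hx)) (fun x hx => hps x (hrU hx)) (fun x hx => hqs x (hrU hx))
    (fun x hx => ((hNs x (hrU hx)).comp x (hBs x (hrU hx))).div (hBs x (hrU hx))
      (hBpos x (hrU hx)).ne')
    (fun x hx => div_pos (normFactor_pos _) (hBpos x (hrU hx))) (fun x hx => he₀ x (hrU hx))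
    (fun x hx => hΔ x (hrU hx)) (fun x hx => hBpos x (hrU hx)) (fun x hx => hB x (hrU hx))
    (fun x hx => (hforms x (hrU hx)).2.1) (fun x hx => (hforms x (hrU hx)).2.2)
    (Metric.mem_ball_self hr)
  obtain ⟨hVo, hψs, hψi, hψV, hψd⟩ := hψ
  have hVU : ∀ z ∈ V, ψ z ∈ U := fun z hz => hrU (hψV ⟨z, hz, rfl⟩)
  have hψat : ∀ z ∈ V, ContDiffAt ℝ (⊤ : ℕ∞) ψ z := fun z hz => hψs.contDiffAt (hVo.mem_nhds hz)
  have hN0 : ∀ t, 0 < N t := fun t => normFactor_pos t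
  refine ⟨V, ψ, ⟨hVo, hψs, hψi, hψV.trans hrU, hψd⟩, hxV, fun z => B (ψ z), fun _ => 1, fun _ => 0,
    fun z => 1 / 2 * Real.log (B (ψ z) / N (B (ψ z)) ^ 2),
    fun z hz => ((hBs _ (hVU z hz)).comp z (hψat z hz)).contDiffWithinAt, contDiffOn_const,
    contDiffOn_const, fun z hz => hBpos _ (hVU z hz), fun z hz => ?_, fun z hz => ?_,
    fun z hz y => ?_⟩
  · have h1 := hBpos _ (hVU z hz)
    have h2 := hN0 (B (ψ z))
    change _ = B (ψ z) / (N (B (ψ z)) ^ 2 * (1 ^ 2 + 0 ^ 2))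
    rw [← mul_assoc, mul_one_div_cancel two_ne_zero, one_mul, Real.exp_log (by positivity)]
    norm_num
  · have hz0 : lform p q (ψ z) (fderiv ℝ ψ z (Pi.single 1 1)) = 0 := by
      have h := (hform z hz (Pi.single 1 1)).1
      rw [Pi.single_eq_of_ne (by simp)] at h
      exact (mul_eq_zero.1 h).resolve_left (div_pos (hN0 _) (hBpos _ (hVU z hz))).ne'
    have hdB := fderiv_apply_eq_zero_of_lform_eq_zero (hpq _ (hVU z hz)) (hforms _ (hVU z hz)).1 hz0
    have hG : DifferentiableAt ℝ (fun t => 1 / 2 * Real.log (t / N t ^ 2)) (B (ψ z)) := by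
      have h1 := hBpos _ (hVU z hz)
      have h2 := hN0 (B (ψ z))
      have hNd := (hNs _ (hVU z hz)).differentiableAt (by simp)
      exact ((differentiableAt_id.div (hNd.pow 2) (pow_ne_zero 2 h2.ne')).log (by
        simpa using ⟨h1.ne', h2.ne'⟩)).const_mul _
    have hBψ : HasFDerivAt (fun z => B (ψ z)) ((fderiv ℝ B (ψ z)).comp (fderiv ℝ ψ z)) z :=
      (hdiff hBs _ (hVU z hz)).hasFDerivAt.comp z
        ((hψat z hz).differentiableAt (by simp)).hasFDerivAt
    have hσ : pd (fun z => 1 / 2 * Real.log (B (ψ z) / N (B (ψ z)) ^ 2)) 1 z = 0 := by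
      have h := (hG.hasDerivAt.comp_hasFDerivAt z hBψ).fderiv
      unfold pd
      change fderiv ℝ ((fun t => 1 / 2 * Real.log (t / N t ^ 2)) ∘ fun z => B (ψ z)) z _ = 0
      rw [h]
      simp [hdB]
    rw [hσ]
    simp [pd]
  · have h1 := hBpos _ (hVU z hz)
    have h2 := hN0 (B (ψ z))
    obtain ⟨h3, h4⟩ := hform z hz y
    change alphaF a (ψ z) (fderiv ℝ ψ z y) = √(B (ψ z)) / N (B (ψ z)) * √(_ / (1 ^ 2 + 0 ^ 2)) ∧
      betaF b (ψ z) (fderiv ℝ ψ z y)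
        = B (ψ z) * (1 * y 0 + 0 * y 1) / (N (B (ψ z)) * (1 ^ 2 + 0 ^ 2))
    rw [alphaF_eq_sqrt_qform (hsym' _ (hVU z hz)), betaF_eq_lform]
    change √(qform e f g (ψ z) (fderiv ℝ ψ z y)) = _ ∧ lform p q (ψ z) (fderiv ℝ ψ z y) = _
    constructor
    · rw [show qform e f g (ψ z) (fderiv ℝ ψ z y)
          = B (ψ z) / N (B (ψ z)) ^ 2 * ((y 0 ^ 2 + y 1 ^ 2) / (1 ^ 2 + 0 ^ 2)) by
            rw [← h4]
            field_simp
            norm_num,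
        Real.sqrt_mul (by positivity), Real.sqrt_div h1.le, Real.sqrt_sq h2.le]
    · rw [← h3]
      field_simp
      norm_num

end
end

section
/- Let ε ∈ {1,−1} and let c₁, c₂, c₃, c₄ be constants with c₃ > 0. On the open set U ⊆ ℝ² where c₃ − ε(x¹+c₁)² − ε(x²+c₂)² > 0, define σ(x) = ln[c₃ − ε(x¹+c₁)² − ε(x²+c₂)²] + c₄, ξ(x) = ε(1/√2)(x²+c₂)/√(c₃ − ε(x¹+c₁)² − ε(x²+c₂)²), η(x) = −ε(1/√2)(x¹+c₁)/√(c₃ − ε(x¹+c₁)² − ε(x²+c₂)²), and set α = e^{σ(x)}√((y¹)²+(y²)²), β = e^{σ(x)}(ξ(x)y¹ + η(x)y²). Then the Finsler metric F = α + εβ²/α satisfies the Hamel equations F_{x^my^l}y^m − F_{x^l} = 0 on U (hence F is projectively flat), while the 1-form e^σ(ξ dx¹ + η dx²) is not closed. -/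
open scoped BigOperators
open Real

noncomputable section

/-- The Hamel operator at `x` only depends on the germ at `x` of `x' ↦ F x'`. -/
theorem Hamel_congr {F G : Pt → (Fin 2 → ℝ) → ℝ} {x : Pt} (h : F =ᶠ[nhds x] G)
    (y : Fin 2 → ℝ) (l : Fin 2) : Hamel F x y l = Hamel G x y l := by
  have hy : (fun x' => fderiv ℝ (fun y' => F x' y') y (Pi.single l 1)) =ᶠ[nhds x]
      fun x' => fderiv ℝ (fun y' => G x' y') y (Pi.single l 1) := by
    filter_upwards [h] with z hz
    rw [hz]
  have hx : (fun x' => F x' y) =ᶠ[nhds x] fun x' => G x' y := by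
    filter_upwards [h] with z hz
    rw [hz]
  rw [Hamel, Hamel, hy.fderiv_eq, hx.fderiv_eq]

theorem hasFDerivAt_coord (i : Fin 2) (x : Pt) :
    HasFDerivAt (fun z : Pt => z i) (ContinuousLinearMap.proj (R := ℝ) i) x :=
  (ContinuousLinearMap.proj (R := ℝ) (φ := fun _ : Fin 2 => ℝ) i).hasFDerivAt

theorem sq_add_sq_pos_of_ne_zero {y : Fin 2 → ℝ} (hy : y ≠ 0) : 0 < (y 0)^2 + (y 1)^2 := by
  have h : y 0 ≠ 0 ∨ y 1 ≠ 0 := by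
    by_contra! h
    exact hy (funext (Fin.forall_fin_two.2 h))
  rcases h with h | h <;> positivity

/-- On its domain the metric `α + ε β² / α` takes this form, which is polynomial in `x`. -/
def reducedMetric (ε c₁ c₂ c₃ c₄ : ℝ) (x : Pt) (y : Fin 2 → ℝ) : ℝ :=
  Real.exp c₄ * ((c₃ - ε*(x 0 + c₁)^2 - ε*(x 1 + c₂)^2) * Real.sqrt ((y 0)^2 + (y 1)^2)
    + ε / 2 * ((x 1 + c₂) * y 0 - (x 0 + c₁) * y 1)^2 * (Real.sqrt ((y 0)^2 + (y 1)^2))⁻¹)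

theorem fderiv_reducedMetric_snd (ε c₁ c₂ c₃ c₄ : ℝ) (x : Pt) {y : Fin 2 → ℝ} (hy : y ≠ 0)
    (l : Fin 2) :
    fderiv ℝ (fun y' => reducedMetric ε c₁ c₂ c₃ c₄ x y') y (Pi.single l 1) =
      Real.exp c₄ * ((c₃ - ε*(x 0 + c₁)^2 - ε*(x 1 + c₂)^2) *
          (y l / Real.sqrt ((y 0)^2 + (y 1)^2))
        + ε * ((x 1 + c₂) * y 0 - (x 0 + c₁) * y 1) *
          ((x 1 + c₂) * (Pi.single l 1 : Pt) 0 - (x 0 + c₁) * (Pi.single l 1 : Pt) 1) *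
          (Real.sqrt ((y 0)^2 + (y 1)^2))⁻¹
        - ε / 2 * ((x 1 + c₂) * y 0 - (x 0 + c₁) * y 1)^2 *
          (y l / Real.sqrt ((y 0)^2 + (y 1)^2) ^ 3)) := by
  have hq := sq_add_sq_pos_of_ne_zero hy
  have hr : Real.sqrt ((y 0)^2 + (y 1)^2) ≠ 0 := (Real.sqrt_pos.2 hq).ne'
  have h0 := hasFDerivAt_coord 0 y
  have h1 := hasFDerivAt_coord 1 y
  have hs := ((h0.pow 2).add (h1.pow 2)).sqrt hq.ne'
  have hi := (hasDerivAt_inv hr).comp_hasFDerivAt y hs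
  have hp := ((h0.const_mul (x 1 + c₂)).sub (h1.const_mul (x 0 + c₁))).pow 2
  have := (((hs.const_mul (c₃ - ε*(x 0 + c₁)^2 - ε*(x 1 + c₂)^2)).add
    ((hp.const_mul (ε / 2)).mul hi)).const_mul (Real.exp c₄)).fderiv
  refine (congrArg (fun L : Pt →L[ℝ] ℝ => L (Pi.single l 1)) this).trans ?_
  fin_cases l <;> simp <;> field_simp <;> ring

theorem Hamel_reducedMetric (ε c₁ c₂ c₃ c₄ : ℝ) (x : Pt) {y : Fin 2 → ℝ} (hy : y ≠ 0)
    (l : Fin 2) : Hamel (reducedMetric ε c₁ c₂ c₃ c₄) x y l = 0 := by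
  have hq := sq_add_sq_pos_of_ne_zero hy
  have hr : Real.sqrt ((y 0)^2 + (y 1)^2) ≠ 0 := (Real.sqrt_pos.2 hq).ne'
  have hr2 := Real.sq_sqrt hq.le
  have h0 := (hasFDerivAt_coord 0 x).add_const c₁
  have h1 := (hasFDerivAt_coord 1 x).add_const c₂
  have hD := ((h0.pow 2).const_mul ε).const_sub c₃ |>.sub ((h1.pow 2).const_mul ε)
  have hp := (h1.mul_const (y 0)).sub (h0.mul_const (y 1))
  have hF := (((hD.mul_const (Real.sqrt ((y 0)^2 + (y 1)^2))).add
    (((hp.pow 2).const_mul (ε / 2)).mul_const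
      (Real.sqrt ((y 0)^2 + (y 1)^2))⁻¹)).const_mul (Real.exp c₄)).fderiv
  have hd := (h1.mul_const ((Pi.single l 1 : Pt) 0)).sub (h0.mul_const ((Pi.single l 1 : Pt) 1))
  have hG := ((((hD.mul_const (y l / Real.sqrt ((y 0)^2 + (y 1)^2))).add
    (((hp.const_mul ε).mul hd).mul_const (Real.sqrt ((y 0)^2 + (y 1)^2))⁻¹)).sub
    (((hp.pow 2).const_mul (ε / 2)).mul_const
      (y l / Real.sqrt ((y 0)^2 + (y 1)^2) ^ 3))).const_mul (Real.exp c₄)).fderiv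
  simp only [Hamel, fderiv_reducedMetric_snd ε c₁ c₂ c₃ c₄ _ hy, Fin.sum_univ_two]
  have hF' := fun m : Fin 2 => congrArg (fun L : Pt →L[ℝ] ℝ => L (Pi.single m 1)) hF
  have hG' := fun m : Fin 2 => congrArg (fun L : Pt →L[ℝ] ℝ => L (Pi.single m 1)) hG
  refine (congrArg₂ (· - ·) (congrArg₂ (· + ·) (congrArg (· * y 0) (hG' 0))
    (congrArg (· * y 1) (hG' 1))) (hF' l)).trans ?_
  generalize Real.sqrt ((y 0)^2 + (y 1)^2) = r at hr hr2 ⊢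
  fin_cases l <;> simp <;> field_simp <;> rw [hr2] <;> ring

/-- Example 1.4 of the paper: an explicit projectively flat metric
`F = α ± β²/α` with `β` not closed. -/
theorem stmt4 (ε : ℝ) (hε : ε = 1 ∨ ε = -1) (c₁ c₂ c₃ c₄ : ℝ) (hc₃ : 0 < c₃) :
    (∀ x : Pt, x ∈ {x : Pt | 0 < c₃ - ε*(x 0 + c₁)^2 - ε*(x 1 + c₂)^2} →
      ∀ y : Fin 2 → ℝ, y ≠ 0 → ∀ l : Fin 2,
        Hamel (fun x y =>
          (Real.exp (Real.log (c₃ - ε*(x 0 + c₁)^2 - ε*(x 1 + c₂)^2) + c₄) *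
              Real.sqrt ((y 0)^2 + (y 1)^2))
          + ε * (Real.exp (Real.log (c₃ - ε*(x 0 + c₁)^2 - ε*(x 1 + c₂)^2) + c₄) *
              ((ε * (1/Real.sqrt 2) * (x 1 + c₂)
                  / Real.sqrt (c₃ - ε*(x 0 + c₁)^2 - ε*(x 1 + c₂)^2)) * y 0
               + (-ε * (1/Real.sqrt 2) * (x 0 + c₁)
                  / Real.sqrt (c₃ - ε*(x 0 + c₁)^2 - ε*(x 1 + c₂)^2)) * y 1))^2
            / (Real.exp (Real.log (c₃ - ε*(x 0 + c₁)^2 - ε*(x 1 + c₂)^2) + c₄) *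
              Real.sqrt ((y 0)^2 + (y 1)^2)))
          x y l = 0) ∧
    -- the 1-form e^σ (ξ dx¹ + η dx²) is not closed
    ¬ (∀ x : Pt, x ∈ {x : Pt | 0 < c₃ - ε*(x 0 + c₁)^2 - ε*(x 1 + c₂)^2} →
      pd (fun z => Real.exp (Real.log (c₃ - ε*(z 0 + c₁)^2 - ε*(z 1 + c₂)^2) + c₄) *
          (ε * (1/Real.sqrt 2) * (z 1 + c₂)
            / Real.sqrt (c₃ - ε*(z 0 + c₁)^2 - ε*(z 1 + c₂)^2))) 1 x =
      pd (fun z => Real.exp (Real.log (c₃ - ε*(z 0 + c₁)^2 - ε*(z 1 + c₂)^2) + c₄) *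
          (-ε * (1/Real.sqrt 2) * (z 0 + c₁)
            / Real.sqrt (c₃ - ε*(z 0 + c₁)^2 - ε*(z 1 + c₂)^2))) 0 x) := by
  have hcont : Continuous fun z : Pt => c₃ - ε*(z 0 + c₁)^2 - ε*(z 1 + c₂)^2 := by fun_prop
  have hε2 : ε ^ 2 = 1 := by rcases hε with rfl | rfl <;> norm_num
  have h2 : Real.sqrt 2 ^ 2 = 2 := Real.sq_sqrt (by norm_num)
  have h2' : Real.sqrt 2 ≠ 0 := by positivity
  refine ⟨fun x hx y hy l => ?_, fun h => ?_⟩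
  · rw [← Hamel_reducedMetric ε c₁ c₂ c₃ c₄ x hy l]
    refine Hamel_congr ?_ y l
    filter_upwards [(isOpen_lt continuous_const hcont).mem_nhds hx] with z hz
    ext w
    change 0 < c₃ - ε*(z 0 + c₁)^2 - ε*(z 1 + c₂)^2 at hz
    have hs := Real.sq_sqrt hz.le
    have hs' := (Real.sqrt_pos.2 hz).ne'
    rw [reducedMetric, Real.exp_add, Real.exp_log hz]
    by_cases hw : Real.sqrt ((w 0)^2 + (w 1)^2) = 0
    · simp [hw]
    generalize c₃ - ε*(z 0 + c₁)^2 - ε*(z 1 + c₂)^2 = D at *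
    have hE := Real.exp_ne_zero c₄
    have hz' := hz.ne'
    field_simp
    rw [hs, h2]
    rw [show ε ^ 3 = ε by rw [pow_succ, hε2, one_mul]]
    ring
  · have hc : 0 < c₃ - ε*((![-c₁, -c₂] : Pt) 0 + c₁)^2 - ε*((![-c₁, -c₂] : Pt) 1 + c₂)^2 := by
      simpa using hc₃
    have hx := h ![-c₁, -c₂] hc
    have h0 := (hasFDerivAt_coord 0 ![-c₁, -c₂]).add_const c₁
    have h1 := (hasFDerivAt_coord 1 ![-c₁, -c₂]).add_const c₂
    have hD := ((h0.pow 2).const_mul ε).const_sub c₃ |>.sub ((h1.pow 2).const_mul ε)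
    have hE := ((hD.log hc.ne').add_const c₄).exp
    have hS := (hasDerivAt_inv (Real.sqrt_pos.2 hc).ne').comp_hasFDerivAt ![-c₁, -c₂] (hD.sqrt hc.ne')
    have hL := (hE.mul ((h1.const_mul (ε * (1/Real.sqrt 2))).mul hS)).fderiv
    have hR := (hE.mul ((h0.const_mul (-ε * (1/Real.sqrt 2))).mul hS)).fderiv
    have key := ((congrArg (fun L : Pt →L[ℝ] ℝ => L (Pi.single 1 1)) hL).symm.trans hx).trans
      (congrArg (fun L : Pt →L[ℝ] ℝ => L (Pi.single 0 1)) hR)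
    simp at key
    have hε0 : ε ≠ 0 := by rintro rfl; norm_num at hε2
    have hne : Real.exp (Real.log c₃ + c₄) * ((Real.sqrt c₃)⁻¹ * (ε * (Real.sqrt 2)⁻¹)) ≠ 0 := by
      positivity
    exact hne (self_eq_neg.1 key)

end
end
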